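/- arXiv:1003.5856 — 3 statements merged into one kernel-verified Lean document; each statement's English description precedes it below -/
import Mathlib

section
/- Let q be a prime power and n > 1, and suppose that either q is even or n is not a power of 2. Then the number of self-reciprocal monic irreducible polynomials of degree 2n over F_q equals (1/(2n)) · ∑_{d | n, d odd} μ(d) · q^{n/d}. -/
open Polynomial ArithmeticFunction

theorem aeval_inv_reverse_eq_zero_iff {F K : Type*} [Field F] [Field K] [Algebra F K] {x : K}
    (hx : x ≠ 0) (f : F[X]) : aeval x⁻¹ f.reverse = 0 ↔ aeval x f = 0 := by
  let := invertibleOfNonzero hx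
  rw [aeval_def, aeval_def, ← eval₂_reverse_eq_zero_iff (algebraMap F K) x f, invOf_eq_inv]

theorem reverse_eq_self_of_dvd_reverse {F : Type*} [Field F] {f : F[X]}
    (h1 : f.eval 1 ≠ 0) (h : f ∣ f.reverse) : f.reverse = f := by
  have heval : f.reverse.eval 1 = f.eval 1 := by
    let := invertibleOne (α := F)
    simpa [eval₂_id] using eval₂_reverse_mul_pow (RingHom.id F) 1 f
  have hf0 : f ≠ 0 := by rintro rfl; simp at h1
  obtain ⟨g, hg⟩ := h
  have hg0 : g ≠ 0 := by
    rintro rfl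
    simp [hf0] at hg
  have hdeg : g.natDegree = 0 := by
    have := reverse_natDegree_le f
    rw [hg, natDegree_mul hf0 hg0] at this
    omega
  obtain ⟨c, rfl⟩ := natDegree_eq_zero.1 hdeg
  rw [hg, eval_mul, eval_C, mul_eq_left₀ h1] at heval
  rw [hg, heval, C_1, mul_one]

theorem pow_eq_inv_iff_pow_succ_eq_one {K : Type*} [Field K] {x : K} (hx : x ≠ 0) {j : ℕ} :
    x ^ j = x⁻¹ ↔ x ^ (j + 1) = 1 := by
  rw [pow_succ, ← eq_mul_inv_iff_mul_eq₀ hx, one_mul]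

theorem sq_eq_one_iff_eq_inv {K : Type*} [Field K] {x : K} (hx : x ≠ 0) :
    x ^ 2 = 1 ↔ x = x⁻¹ := by
  rw [← pow_eq_inv_iff_pow_succ_eq_one hx, pow_one]

theorem ne_zero_of_pow_succ_eq_one {K : Type*} [Field K] {x : K} {j : ℕ}
    (h : x ^ (j + 1) = 1) : x ≠ 0 := by
  rintro rfl
  simp at h

theorem pow_pow_two_mul_eq_of_pow_pow_eq_inv {K : Type*} [Field K] {x : K} {q j : ℕ}
    (h : x ^ q ^ j = x⁻¹) : x ^ q ^ (2 * j) = x := by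
  rw [two_mul, pow_add, pow_mul, h, inv_pow, h, inv_inv]

theorem sq_ne_one_of_one_lt_natDegree_minpoly {F K : Type*} [Field F] [Field K] [Algebra F K]
    {x : K} (h : 1 < (minpoly F x).natDegree) : x ^ 2 ≠ 1 := by
  intro hx
  rcases sq_eq_sq_iff_eq_or_eq_neg.1 (hx.trans (one_pow 2).symm) with rfl | rfl
  · rw [minpoly.one, ← C_1, natDegree_X_sub_C] at h
    exact h.false
  · rw [show (-1 : K) = algebraMap F K (-1) by simp, minpoly.eq_X_sub_C,
      natDegree_X_sub_C] at h
    exact h.false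

section FiniteField

variable {F K : Type*} [Field F] [Fintype F] [Field K] [Algebra F K]

theorem minpoly_natDegree_dvd_iff_pow_card_pow_eq {x : K} (hx : IsIntegral F x) {j : ℕ} :
    (minpoly F x).natDegree ∣ j ↔ x ^ Fintype.card F ^ j = x := by
  rw [(minpoly.irreducible hx).natDegree_dvd_iff_dvd_X_pow_card_pow_sub_X, minpoly.dvd_iff,
    Nat.card_eq_fintype_card]
  simp [sub_eq_zero]

theorem pow_card_pow_eq_of_modEq {x : K} (hx : IsIntegral F x) {i j : ℕ}
    (h : i ≡ j [MOD (minpoly F x).natDegree]) :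
    x ^ Fintype.card F ^ i = x ^ Fintype.card F ^ j := by
  wlog hij : i ≤ j generalizing i j
  · exact (this h.symm (le_of_not_ge hij)).symm
  obtain ⟨k, rfl⟩ := Nat.exists_eq_add_of_le hij
  have hk := (minpoly_natDegree_dvd_iff_pow_card_pow_eq hx).1
    ((Nat.modEq_iff_dvd' hij).1 h)
  rw [Nat.add_sub_cancel_left] at hk
  rw [add_comm, pow_add, pow_mul, hk]

theorem pow_card_pow_eq_pow_card_pow_mul_odd {x : K} (hx : IsIntegral F x) {n c : ℕ}
    (hdeg : (minpoly F x).natDegree = 2 * n) (hc : Odd c) :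
    x ^ Fintype.card F ^ n = x ^ Fintype.card F ^ (n * c) := by
  obtain ⟨c, rfl⟩ := hc
  refine pow_card_pow_eq_of_modEq hx ?_
  rw [hdeg, Nat.modEq_iff_dvd' (Nat.le_mul_of_pos_right _ (by omega))]
  exact ⟨c, by rw [mul_add, mul_one, Nat.add_sub_cancel]; ring⟩

theorem exists_pow_card_pow_eq_of_aeval_minpoly_eq_zero {x y : K} (hx : IsIntegral F x)
    (hy : aeval y (minpoly F x) = 0) : ∃ i : ℕ, x ^ Fintype.card F ^ i = y := by
  have hyi : IsIntegral F y := ⟨minpoly F x, minpoly.monic hx, hy⟩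
  let L := IntermediateField.adjoin F {x, y}
  have : FiniteDimensional F L := IntermediateField.finiteDimensional_adjoin <| by
    rintro z (rfl | rfl) <;> assumption
  have : Finite L := Module.finite_of_finite F
  let x' : L := ⟨x, IntermediateField.subset_adjoin _ _ (by simp)⟩
  let y' : L := ⟨y, IntermediateField.subset_adjoin _ _ (by simp)⟩
  have hconj : IsConjRoot F x' y' := by
    rw [← isConjRoot_algHom_iff L.val]
    exact (isConjRoot_iff_aeval_eq_zero hx).2 hy
  obtain ⟨σ, hσ⟩ := isConjRoot_iff_exists_algEquiv.1 hconj.symm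
  let p := ringChar F
  have : Fact p.Prime := ⟨CharP.char_is_prime F p⟩
  obtain ⟨i, hi⟩ := FiniteField.exists_forall_apply_eq_pow F p L σ
  refine ⟨i, ?_⟩
  have := congrArg L.val ((hi x').symm.trans hσ)
  simpa [Nat.card_eq_fintype_card] using this

theorem pow_card_pow_eq_inv_of_reverse_minpoly_eq {x : K} {n : ℕ} (hn : 0 < n)
    (hx : IsIntegral F x) (hdeg : (minpoly F x).natDegree = 2 * n)
    (hrev : (minpoly F x).reverse = minpoly F x) : x ^ (Fintype.card F ^ n + 1) = 1 := by
  have hsq : x ^ 2 ≠ 1 := sq_ne_one_of_one_lt_natDegree_minpoly (F := F) (by omega)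
  have hx0 : x ≠ 0 := by
    rintro rfl
    rw [minpoly.zero, natDegree_X] at hdeg
    omega
  have hinv : aeval x⁻¹ (minpoly F x) = 0 := by
    rw [← hrev, aeval_inv_reverse_eq_zero_iff hx0, minpoly.aeval]
  obtain ⟨i, hi⟩ := exists_pow_card_pow_eq_of_aeval_minpoly_eq_zero hx hinv
  have hdvd := (minpoly_natDegree_dvd_iff_pow_card_pow_eq hx).2
    (pow_pow_two_mul_eq_of_pow_pow_eq_inv hi)
  rw [hdeg, Nat.mul_dvd_mul_iff_left two_pos] at hdvd
  obtain ⟨c, rfl⟩ := hdvd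
  rcases Nat.even_or_odd' c with ⟨c, rfl | rfl⟩
  · have := (minpoly_natDegree_dvd_iff_pow_card_pow_eq hx (j := n * (2 * c))).1
      ⟨c, by rw [hdeg]; ring⟩
    exact absurd ((sq_eq_one_iff_eq_inv hx0).2 (this.symm.trans hi)) hsq
  · rw [← pow_eq_inv_iff_pow_succ_eq_one hx0, ← hi]
    exact pow_card_pow_eq_pow_card_pow_mul_odd hx hdeg ⟨c, rfl⟩

theorem reverse_minpoly_eq_of_pow_card_pow_add_one_eq_one {x : K} {n : ℕ}
    (hx : IsIntegral F x) (hdeg : 1 < (minpoly F x).natDegree)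
    (h : x ^ (Fintype.card F ^ n + 1) = 1) : (minpoly F x).reverse = minpoly F x := by
  have hx0 : x ≠ 0 := ne_zero_of_pow_succ_eq_one h
  have hirr := minpoly.irreducible hx
  refine reverse_eq_self_of_dvd_reverse (fun h1 ↦ ?_) ?_
  · rw [natDegree_eq_of_degree_eq_some (degree_eq_one_of_irreducible_of_root hirr h1)] at hdeg
    exact hdeg.false
  · have hinv : aeval x⁻¹ (minpoly F x) = 0 := by
      rw [← (pow_eq_inv_iff_pow_succ_eq_one hx0).2 h]
      have := aeval_algHom_apply (FiniteField.frobeniusAlgHom F K ^ n) x (minpoly F x)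
      rwa [minpoly.aeval, _root_.map_zero, AlgHom.coe_pow, FiniteField.coe_frobeniusAlgHom,
        pow_iterate] at this
    rw [minpoly.dvd_iff]
    simpa using (aeval_inv_reverse_eq_zero_iff (inv_ne_zero hx0) (minpoly F x)).2 hinv

variable (F K) in
open Classical in
/-- The elements of degree `2 * n` over a finite field `F` that are sent to their inverse by the
`n`-th power of the Frobenius. -/
noncomputable def frobeniusInvertedRoots (n : ℕ) : Finset K :=
  {x ∈ nthRootsFinset (Fintype.card F ^ n + 1) (1 : K) | (minpoly F x).natDegree = 2 * n}

theorem mem_frobeniusInvertedRoots {n : ℕ} {x : K} : x ∈ frobeniusInvertedRoots F K n ↔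
    x ^ (Fintype.card F ^ n + 1) = 1 ∧ (minpoly F x).natDegree = 2 * n := by
  simp [frobeniusInvertedRoots, mem_nthRootsFinset]

theorem card_frobeniusInvertedRoots [IsAlgClosed K] [Algebra.IsIntegral F K] {n : ℕ}
    (hn : 0 < n) : (frobeniusInvertedRoots F K n).card =
      2 * n * {f : F[X] | f.Monic ∧ Irreducible f ∧ f.natDegree = 2 * n ∧
        f.reverse = f}.ncard := by
  classical
  have hint (x : K) : IsIntegral F x := Algebra.IsIntegral.isIntegral x
  have himage : {f : F[X] | f.Monic ∧ Irreducible f ∧ f.natDegree = 2 * n ∧ f.reverse = f} =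
      ((frobeniusInvertedRoots F K n).image (minpoly F) : Finset F[X]) := by
    ext f
    simp only [Set.mem_ofPred_eq, Finset.coe_image, Set.mem_image, Finset.mem_coe,
      mem_frobeniusInvertedRoots]
    constructor
    · rintro ⟨hmonic, hirr, hdeg, hrev⟩
      obtain ⟨x, hx⟩ := IsAlgClosed.exists_aeval_eq_zero K f (degree_pos_of_irreducible hirr).ne'
      obtain rfl := minpoly.eq_of_irreducible_of_monic hirr hx hmonic
      exact ⟨x, ⟨pow_card_pow_eq_inv_of_reverse_minpoly_eq hn (hint x) hdeg hrev, hdeg⟩, rfl⟩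
    · rintro ⟨x, ⟨hx, hdeg⟩, rfl⟩
      exact ⟨minpoly.monic (hint x), minpoly.irreducible (hint x), hdeg,
        reverse_minpoly_eq_of_pow_card_pow_add_one_eq_one (hint x) (by omega) hx⟩
  rw [himage, Set.ncard_coe_finset, mul_comm]
  rw [Finset.card_eq_sum_card_image (minpoly F), Finset.sum_const_nat]
  intro f hf
  rw [← Finset.mem_coe, ← himage] at hf
  obtain ⟨hmonic, hirr, hdeg, hrev⟩ := hf
  rw [← hdeg, ← card_rootSet_eq_natDegree (K := K) (PerfectField.separable_of_irreducible hirr)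
    (IsAlgClosed.splits _), ← Nat.card_eq_fintype_card, Nat.card_coe_set_eq,
    ← Set.ncard_coe_finset]
  congr 1
  ext x
  simp only [Finset.coe_filter, Set.mem_ofPred_eq, mem_frobeniusInvertedRoots,
    mem_rootSet_of_ne hirr.ne_zero]
  constructor
  · rintro ⟨-, rfl⟩
    exact minpoly.aeval F x
  · intro hx
    obtain rfl := minpoly.eq_of_irreducible_of_monic hirr hx hmonic
    exact ⟨⟨pow_card_pow_eq_inv_of_reverse_minpoly_eq hn (hint x) hdeg hrev, hdeg⟩, rfl⟩

theorem sq_ne_one_iff_exists_natDegree_minpoly_eq {x : K} (hx : IsIntegral F x) {k m : ℕ}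
    (hm : Odd m) (h : x ^ (Fintype.card F ^ (2 ^ k * m) + 1) = 1) :
    x ^ 2 ≠ 1 ↔ ∃ d, d ∣ m ∧ (minpoly F x).natDegree = 2 ^ (k + 1) * d := by
  constructor
  · intro hsq
    have hx0 := ne_zero_of_pow_succ_eq_one h
    have hinv := (pow_eq_inv_iff_pow_succ_eq_one hx0).2 h
    have hdvd := (minpoly_natDegree_dvd_iff_pow_card_pow_eq hx).2
      (pow_pow_two_mul_eq_of_pow_pow_eq_inv hinv)
    have hndvd : ¬ (minpoly F x).natDegree ∣ 2 ^ k * m := fun hdvd ↦ hsq <|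
      (sq_eq_one_iff_eq_inv hx0).2 <|
        ((minpoly_natDegree_dvd_iff_pow_card_pow_eq hx).1 hdvd).symm.trans hinv
    rw [← mul_assoc, ← pow_succ'] at hdvd
    obtain ⟨j, d, hd, hjd⟩ :=
      Nat.exists_eq_two_pow_mul_odd (minpoly.natDegree_pos hx).ne'
    rw [hjd] at hdvd hndvd ⊢
    have hdm : d ∣ m := (Nat.Coprime.pow_right (k + 1) hd.coprime_two_right).dvd_of_dvd_mul_left
      ((Dvd.intro_left _ rfl).trans hdvd)
    have hjk : j ≤ k + 1 := (Nat.pow_dvd_pow_iff_le_right one_lt_two).1 <|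
      (Nat.Coprime.pow_left j hm.coprime_two_left).dvd_of_dvd_mul_right
        ((Dvd.intro _ rfl).trans hdvd)
    have hkj : k < j := by
      by_contra! hle
      exact hndvd (mul_dvd_mul (pow_dvd_pow 2 hle) hdm)
    exact ⟨d, hdm, by rw [show j = k + 1 by omega]⟩
  · rintro ⟨d, hd, hdeg⟩
    refine sq_ne_one_of_one_lt_natDegree_minpoly (F := F) ?_
    have := Nat.pos_of_dvd_of_pos hd hm.pos
    rw [hdeg, pow_succ']
    nlinarith [Nat.one_le_two_pow (n := k), Nat.mul_le_mul (Nat.one_le_two_pow (n := k)) this]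

open Classical in
theorem card_filter_sq_ne_one_nthRootsFinset [Algebra.IsIntegral F K] (k : ℕ) {m : ℕ}
    (hm : Odd m) :
    ({x ∈ nthRootsFinset (Fintype.card F ^ (2 ^ k * m) + 1) (1 : K) | x ^ 2 ≠ 1}).card =
      ∑ d ∈ m.divisors, (frobeniusInvertedRoots F K (2 ^ k * d)).card := by
  have hint (x : K) : IsIntegral F x := Algebra.IsIntegral.isIntegral x
  have hpos : 0 < 2 ^ (k + 1) := by positivity
  rw [Finset.card_eq_sum_card_fiberwise (t := m.divisors)
    (f := fun x : K ↦ (minpoly F x).natDegree / 2 ^ (k + 1))]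
  · refine Finset.sum_congr rfl fun d hd ↦ congrArg _ ?_
    have hdm := Nat.dvd_of_mem_divisors hd
    obtain ⟨c, rfl⟩ := hdm
    ext x
    simp only [Finset.mem_filter, mem_nthRootsFinset (Nat.succ_pos _),
      mem_frobeniusInvertedRoots, ← mul_assoc, ← pow_succ']
    constructor
    · rintro ⟨⟨hx, hsq⟩, hdeg⟩
      rw [mul_assoc] at hx
      obtain ⟨e, -, he⟩ := (sq_ne_one_iff_exists_natDegree_minpoly_eq (hint x) hm hx).1 hsq
      rw [he, Nat.mul_div_cancel_left _ hpos] at hdeg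
      subst hdeg
      have hx0 := ne_zero_of_pow_succ_eq_one hx
      refine ⟨?_, he⟩
      rw [← pow_eq_inv_iff_pow_succ_eq_one hx0] at hx ⊢
      rw [← hx, ← mul_assoc]
      exact pow_card_pow_eq_pow_card_pow_mul_odd (hint x) (by rw [he]; ring)
        (Nat.odd_mul.1 hm).2
    · rintro ⟨hx, hdeg⟩
      have hx0 := ne_zero_of_pow_succ_eq_one hx
      have hx' : x ^ (Fintype.card F ^ (2 ^ k * (d * c)) + 1) = 1 := by
        rw [← pow_eq_inv_iff_pow_succ_eq_one hx0] at hx ⊢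
        rw [← hx, ← mul_assoc]
        exact (pow_card_pow_eq_pow_card_pow_mul_odd (hint x) (by rw [hdeg]; ring)
          (Nat.odd_mul.1 hm).2).symm
      refine ⟨⟨by rwa [mul_assoc], ?_⟩, by rw [hdeg, Nat.mul_div_cancel_left _ hpos]⟩
      exact (sq_ne_one_iff_exists_natDegree_minpoly_eq (hint x) hm hx').2
        ⟨d, Dvd.intro _ rfl, hdeg⟩
  · intro x hx
    simp only [Finset.coe_filter, Set.mem_ofPred_eq, mem_nthRootsFinset (Nat.succ_pos _)] at hx
    obtain ⟨d, hd, he⟩ := (sq_ne_one_iff_exists_natDegree_minpoly_eq (hint x) hm hx.1).1 hx.2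
    simp only [he, Nat.mul_div_cancel_left _ hpos]
    exact Nat.mem_divisors.2 ⟨hd, hm.pos.ne'⟩

variable (F K) in
theorem card_nthRootsFinset_card_pow_add_one [IsAlgClosed K] {n : ℕ} (hn : n ≠ 0) :
    (nthRootsFinset (Fintype.card F ^ n + 1) (1 : K)).card = Fintype.card F ^ n + 1 := by
  have hcard : (Fintype.card F : K) = 0 := by
    rw [← map_natCast (algebraMap F K), FiniteField.cast_card_eq_zero, _root_.map_zero]
  have : NeZero ((Fintype.card F ^ n + 1 : ℕ) : K) := ⟨by simp [hcard, hn]⟩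
  obtain ⟨ζ, hζ⟩ := HasEnoughRootsOfUnity.exists_primitiveRoot K (Fintype.card F ^ n + 1)
  exact hζ.card_nthRootsFinset

variable (F) in
theorem neg_one_pow_card_pow_add_one_eq_one (n : ℕ) :
    (-1 : K) ^ (Fintype.card F ^ n + 1) = 1 := by
  have hfrob := congrArg (algebraMap F K) (FiniteField.pow_card_pow n (-1 : F))
  simp only [map_pow, map_neg, map_one] at hfrob
  rw [pow_succ, hfrob, neg_mul_neg, one_mul]

open Classical in
variable (F K) in
theorem filter_sq_eq_one_nthRootsFinset (n : ℕ) :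
    {x ∈ nthRootsFinset (Fintype.card F ^ n + 1) (1 : K) | x ^ 2 = 1} = {1, -1} := by
  ext x
  simp only [Finset.mem_filter, mem_nthRootsFinset (Nat.succ_pos _), Finset.mem_insert,
    Finset.mem_singleton]
  constructor
  · rintro ⟨-, hx⟩
    simpa using sq_eq_sq_iff_eq_or_eq_neg.1 (hx.trans (one_pow 2).symm)
  · rintro (rfl | rfl)
    · simp
    · exact ⟨neg_one_pow_card_pow_add_one_eq_one F n, by simp⟩

open Classical in
variable (F K) in
theorem sum_card_frobeniusInvertedRoots [IsAlgClosed K] [Algebra.IsIntegral F K] (k : ℕ) {m : ℕ}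
    (hm : Odd m) :
    ∑ d ∈ m.divisors, ((frobeniusInvertedRoots F K (2 ^ k * d)).card : ℤ) =
      (Fintype.card F : ℤ) ^ (2 ^ k * m) + (1 - (({1, -1} : Finset K).card : ℤ)) := by
  rw [← Nat.cast_sum, ← card_filter_sq_ne_one_nthRootsFinset k hm]
  have hcard := Finset.card_filter_add_card_filter_not
    (s := nthRootsFinset (Fintype.card F ^ (2 ^ k * m) + 1) (1 : K)) (fun x ↦ x ^ 2 = 1)
  rw [filter_sq_eq_one_nthRootsFinset, card_nthRootsFinset_card_pow_add_one F K
    (mul_ne_zero (by positivity) hm.pos.ne')] at hcard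
  zify at hcard
  linarith

end FiniteField

theorem sum_divisors_moebius {m : ℕ} (h1 : m ≠ 1) : ∑ d ∈ m.divisors, moebius d = 0 := by
  rw [← coe_zeta_mul_apply, coe_zeta_mul_moebius, one_apply_ne h1]

theorem filter_odd_divisors_two_pow_mul (k : ℕ) {m : ℕ} (hm : Odd m) :
    (2 ^ k * m).divisors.filter (fun d ↦ Odd d) = m.divisors := by
  have hm0 := hm.pos.ne'
  ext d
  simp only [Finset.mem_filter, Nat.mem_divisors]
  constructor
  · rintro ⟨⟨hd, -⟩, hodd⟩
    exact ⟨(Nat.Coprime.pow_right k hodd.coprime_two_right).dvd_of_dvd_mul_left hd, hm0⟩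
  · rintro ⟨hd, -⟩
    exact ⟨⟨hd.mul_left _, mul_ne_zero (by positivity) hm0⟩, hm.of_dvd_nat hd⟩

/-- Carlitz: for a prime power `q` and `n > 1` with `q` even or `n` not a power of 2,
the number of self-reciprocal monic irreducible polynomials of degree `2n` over `F_q`
is `(1/(2n)) ∑_{d ∣ n, d odd} μ(d) q^{n/d}`. -/
theorem carlitz_general (F : Type*) [Field F] [Fintype F] (q n : ℕ)
    (hF : Fintype.card F = q) (hn : 1 < n) (h : Even q ∨ ¬ ∃ m : ℕ, n = 2 ^ m) :
    (2 * n : ℤ) * ({f : Polynomial F | f.Monic ∧ Irreducible f ∧ f.natDegree = 2 * n ∧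
        f.reverse = f}.ncard : ℤ)
      = ∑ d ∈ n.divisors.filter (fun d => Odd d), (moebius d : ℤ) * (q : ℤ) ^ (n / d) := by
  classical
  subst hF
  let K := AlgebraicClosure F
  obtain ⟨k, m, hm, rfl⟩ := Nat.exists_eq_two_pow_mul_odd (show n ≠ 0 by omega)
  have hinv := (sum_eq_iff_sum_mul_moebius_eq_on {m | Odd m}
    (fun _ _ hd hodd ↦ Odd.of_dvd_nat hodd hd)).1
    (fun m _ hm ↦ sum_card_frobeniusInvertedRoots F K k hm) m hm.pos hm
  have hcount := card_frobeniusInvertedRoots (F := F) (K := K) (n := 2 ^ k * m) (by omega)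
  rw [hcount] at hinv
  push_cast at hinv ⊢
  rw [← hinv, filter_odd_divisors_two_pow_mul k hm,
    Nat.sum_divisorsAntidiagonal fun i j ↦ (moebius i : ℤ) *
      ((Fintype.card F : ℤ) ^ (2 ^ k * j) + (1 - (({1, -1} : Finset K).card : ℤ)))]
  simp only [mul_add, Finset.sum_add_distrib, ← Finset.sum_mul]
  have hvanish : (∑ d ∈ m.divisors, moebius d) * (1 - (({1, -1} : Finset K).card : ℤ)) = 0 := by
    rcases h with heven | hpow
    · have hchar : ringChar F = 2 :=
        FiniteField.even_card_iff_char_two.2 (Nat.even_iff.1 heven)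
      have : CharP F 2 := hchar ▸ ringChar.charP F
      have : CharP K 2 := charP_of_injective_algebraMap' F 2
      simp [CharTwo.neg_eq]
    · rw [sum_divisors_moebius, zero_mul]
      rintro rfl
      exact hpow ⟨k, mul_one _⟩
  rw [hvanish, add_zero]
  exact Finset.sum_congr rfl fun d hd ↦ by
    rw [Nat.mul_div_assoc _ (Nat.dvd_of_mem_divisors hd)]
end

section
/- Let q be an odd prime power, n = 2^m with m ≥ 1, and let g(x), h(x) ∈ F_q[x] be coprime polynomials with max(deg g, deg h) = 2. Then the number of monic irreducible polynomials f(x) of degree n over F_q for which h(x)^n · f(g(x)/h(x)) is irreducible over F_q equals (q^n − 1)/(2n). -/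
open Polynomial

section FiniteFieldSquares

variable {K : Type*} [Field K]

theorem isSquare_algebraMap_of_even_finrank {M : Type*} [Field M] [Finite M] [Finite K]
    [Algebra M K] (hK : ringChar K ≠ 2) (heven : Even (Module.finrank M K)) (a : M) :
    IsSquare (algebraMap M K a) := by
  have := Fintype.ofFinite K
  have := Fintype.ofFinite M
  by_cases ha : a = 0
  · simp [ha]
  have ha' : algebraMap M K a ≠ 0 := by simpa using ha
  rw [FiniteField.isSquare_iff hK ha']
  have hodd : Fintype.card K % 2 = 1 := FiniteField.odd_card_of_char_ne_two hK
  have hcard : Fintype.card K = Fintype.card M ^ Module.finrank M K := Module.card_eq_pow_finrank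
  obtain ⟨k, hk⟩ := heven
  have hdvd : Fintype.card M - 1 ∣ Fintype.card K / 2 := by
    obtain ⟨r, hr⟩ : ∃ r, Fintype.card M = r + 1 := Nat.exists_eq_add_one.2 Fintype.card_pos
    have hsq : Fintype.card K = ((r + 1) ^ 2) ^ k := by rw [hcard, hk, hr, ← pow_mul]; ring_nf
    have hr2 : Even r := by
      by_contra hcon
      have h1 : Even (r + 1) := (Nat.not_even_iff_odd.1 hcon).add_one
      have h2 : Even (Fintype.card K) := by
        rw [hcard, hr]
        exact h1.pow_of_ne_zero Module.finrank_pos.ne'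
      rw [Nat.even_iff] at h2
      omega
    obtain ⟨t, rfl⟩ := hr2
    have h1 : ((t + t + 1) ^ 2 - 1) ∣ ((t + t + 1) ^ 2) ^ k - 1 := by
      simpa using Nat.sub_dvd_pow_sub_pow ((t + t + 1) ^ 2) 1 k
    obtain ⟨s, hs⟩ := h1
    have h2 : (t + t + 1) ^ 2 - 1 = 2 * ((t + t) * (t + 1)) := by
      rw [show (t + t + 1) ^ 2 = 2 * ((t + t) * (t + 1)) + 1 by ring]; simp
    rw [h2, ← hsq] at hs
    refine ⟨(t + 1) * s, ?_⟩
    rw [hr, Nat.add_sub_cancel]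
    have h3 : Fintype.card K - 1 = 2 * ((t + t) * ((t + 1) * s)) := by rw [hs]; ring
    omega
  obtain ⟨s, hs⟩ := hdvd
  rw [← map_pow, hs, pow_mul, FiniteField.pow_card_sub_one_eq_one a ha, one_pow, map_one]

theorem two_mul_ncard_not_isSquare [Finite K] (hK : ringChar K ≠ 2) :
    2 * {x : K | ¬IsSquare x}.ncard = Nat.card K - 1 := by
  classical
  have := Fintype.ofFinite K
  have h0 := quadraticChar_sum_zero (F := K) hK
  have hpoint : ∀ x : K, quadraticChar K x =
      1 - (if x = 0 then 1 else 0) - 2 * (if ¬IsSquare x then 1 else 0) := by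
    intro x
    by_cases hx : x = 0
    · simp [hx]
    by_cases hs : IsSquare x
    · simp [hx, hs, (quadraticChar_one_iff_isSquare hx).2 hs]
    · simp [hx, hs, quadraticChar_neg_one_iff_not_isSquare.2 hs]
  rw [Finset.sum_congr rfl fun x _ ↦ hpoint x, Finset.sum_sub_distrib, Finset.sum_sub_distrib,
    ← Finset.mul_sum, Finset.sum_boole, Finset.sum_boole] at h0
  have hn : {x : K | ¬IsSquare x}.ncard = (Finset.univ.filter fun x : K ↦ ¬IsSquare x).card := by
    rw [← Set.ncard_coe_finset]; simp
  rw [hn, Nat.card_eq_fintype_card]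
  have := Fintype.card_pos (α := K)
  have hzero : (Finset.univ.filter fun x : K ↦ x = 0).card = 1 :=
    Finset.card_eq_one.2 ⟨0, by ext; simp⟩
  rw [hzero, Finset.sum_const, Finset.card_univ, nsmul_one] at h0
  omega

theorem ncard_not_isSquare_quadratic (h2 : (2 : K) ≠ 0) {a b c : K} (ha : IsSquare a)
    (hd : IsSquare (discrim a b c)) (hd0 : discrim a b c ≠ 0) :
    {x : K | ¬IsSquare (a * x ^ 2 + b * x + c)}.ncard = {x : K | ¬IsSquare x}.ncard := by
  by_cases ha0 : a = 0
  · subst ha0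
    have hb : b ≠ 0 := by rintro rfl; simp [discrim] at hd0
    refine Set.ncard_congr (fun x _ ↦ b * x + c) ?_ ?_ ?_
    · intro x hx
      simpa using hx
    · intro x y _ _ hxy
      simpa [hb] using hxy
    · intro y hy
      have hby : b * ((y - c) / b) + c = y := by field_simp; ring
      exact ⟨(y - c) / b, by simpa [hby] using hy, hby⟩
  · obtain ⟨e, he⟩ := ha
    obtain ⟨d, hd⟩ := hd
    have hd1 : d ≠ 0 := by rintro rfl; simp [hd] at hd0
    have he1 : e ≠ 0 := by rintro rfl; simp [he] at ha0
    obtain ⟨r, hr⟩ : ∃ r, r = (-b + d) / (2 * a) := ⟨_, rfl⟩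
    obtain ⟨s, hs⟩ : ∃ s, s = (-b - d) / (2 * a) := ⟨_, rfl⟩
    have hrs : r - s ≠ 0 := by
      have : r - s = d / a := by rw [hr, hs]; field_simp; ring
      rw [this]
      exact div_ne_zero hd1 ha0
    have hfac (x : K) : a * x ^ 2 + b * x + c = a * ((x - r) * (x - s)) := by
      have hsum : a * (r + s) = -b := by rw [hr, hs]; field_simp; ring
      have hprod : a * (r * s) = c := by
        have : 4 * a * c = b ^ 2 - d * d := by rw [← hd, discrim]; ring
        have h4 : (4 : K) ≠ 0 := by
          rw [show (4 : K) = 2 * 2 by norm_num]; exact mul_ne_zero h2 h2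
        have h5 : r * s = (b ^ 2 - d * d) / (4 * a * a) := by
          rw [hr, hs]; field_simp; ring
        rw [h5, ← this]; field_simp
      linear_combination x * hsum - hprod
    have hiff (x : K) :
        IsSquare (a * x ^ 2 + b * x + c) ↔ IsSquare ((x - r) / (x - s)) := by
      rw [hfac]
      by_cases hx : x - s = 0
      · simp [hx]
      constructor
      · rintro ⟨y, hy⟩
        refine ⟨y / (e * (x - s)), ?_⟩
        rw [he] at hy
        field_simp
        linear_combination hy
      · rintro ⟨y, hy⟩
        refine ⟨e * (x - s) * y, ?_⟩
        rw [div_eq_iff hx] at hy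
        rw [he, hy]; ring
    refine Set.ncard_congr (fun x _ ↦ (x - r) / (x - s)) ?_ ?_ ?_
    · intro x hx
      rwa [Set.mem_ofPred_eq, hiff] at hx
    · intro x y hx hy hxy
      rw [Set.mem_ofPred_eq, hiff] at hx hy
      have hxs : x - s ≠ 0 := fun h ↦ hx (by simp [h])
      have hys : y - s ≠ 0 := fun h ↦ hy (by simp [h])
      rw [div_eq_div_iff hxs hys] at hxy
      refine mul_left_cancel₀ hrs ?_
      linear_combination hxy
    · intro y hy
      have hy1 : 1 - y ≠ 0 := by
        intro h
        rw [← sub_eq_zero.1 h] at hy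
        simp at hy
      have hxs : (r - s * y) / (1 - y) - s ≠ 0 := by
        rw [show (r - s * y) / (1 - y) - s = (r - s) / (1 - y) by field_simp; ring]
        exact div_ne_zero hrs hy1
      have hxy : ((r - s * y) / (1 - y) - r) / ((r - s * y) / (1 - y) - s) = y := by
        rw [div_eq_iff hxs]; field_simp; ring
      refine ⟨(r - s * y) / (1 - y), ?_, hxy⟩
      rw [Set.mem_ofPred_eq, hiff, hxy]
      exact hy

end FiniteFieldSquares

section QuadraticTransform

variable {F : Type*} [Field F]

/-- The homogenized composition `h ^ n * f (g / h)`. -/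
noncomputable def quadTransform (n : ℕ) (g h f : F[X]) : F[X] :=
  ∑ i ∈ Finset.range (n + 1), C (f.coeff i) * g ^ i * h ^ (n - i)

theorem aeval_quadTransform {A : Type*} [CommRing A] [Algebra F A] {n : ℕ} {g h f : F[X]}
    (hf : f.natDegree = n) {x y : A} (hxy : aeval y g = x * aeval y h) :
    aeval y (quadTransform n g h f) = aeval y h ^ n * aeval x f := by
  rw [quadTransform, map_sum, aeval_eq_sum_range (p := f), hf, Finset.mul_sum]
  refine Finset.sum_congr rfl fun i hi ↦ ?_
  have hin : i ≤ n := Nat.lt_succ_iff.1 (Finset.mem_range.1 hi)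
  simp only [map_mul, map_pow, aeval_C, hxy, Algebra.smul_def]
  have hpow : aeval y h ^ n = aeval y h ^ (n - i) * aeval y h ^ i := by
    rw [← pow_add, Nat.sub_add_cancel hin]
  rw [hpow]
  ring

theorem natDegree_quadTransform {n : ℕ} {g h f : F[X]} (hg : g.natDegree ≤ 2)
    (hh : h.natDegree ≤ 2) (hgh : g.coeff 2 ≠ 0 ∨ h.coeff 2 ≠ 0) (hf : f.natDegree = n)
    (hirr : Irreducible f) (hn : 2 ≤ n) : (quadTransform n g h f).natDegree = 2 * n := by
  have hterm (i : ℕ) (hi : i ≤ n) :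
      (C (f.coeff i) * g ^ i * h ^ (n - i)).natDegree ≤ 2 * n ∧
      (C (f.coeff i) * g ^ i * h ^ (n - i)).coeff (2 * n) =
        f.coeff i * g.coeff 2 ^ i * h.coeff 2 ^ (n - i) := by
    have h1 : (g ^ i).natDegree ≤ i * 2 := natDegree_pow_le_of_le i hg
    have h2 : (h ^ (n - i)).natDegree ≤ (n - i) * 2 := natDegree_pow_le_of_le _ hh
    have h3 : 2 * n = i * 2 + (n - i) * 2 := by omega
    rw [mul_assoc]
    constructor
    · refine (natDegree_C_mul_le _ _).trans ?_
      rw [h3]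
      exact natDegree_mul_le_of_le h1 h2
    · rw [coeff_C_mul, h3, coeff_mul_add_eq_of_natDegree_le h1 h2,
        coeff_pow_of_natDegree_le hg, coeff_pow_of_natDegree_le hh, mul_assoc]
  refine natDegree_eq_of_le_of_coeff_ne_zero ?_ ?_
  · exact natDegree_sum_le_of_forall_le _ _ fun i hi ↦
      (hterm i (Nat.lt_succ_iff.1 (Finset.mem_range.1 hi))).1
  · rw [quadTransform, finsetSum_coeff, Finset.sum_congr rfl fun i hi ↦
      (hterm i (Nat.lt_succ_iff.1 (Finset.mem_range.1 hi))).2]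
    by_cases hh2 : h.coeff 2 = 0
    · have hg2 := hgh.resolve_right (not_not.2 hh2)
      rw [Finset.sum_range_succ, Finset.sum_eq_zero]
      · have : f.coeff n ≠ 0 := by
          rw [← hf]; exact leadingCoeff_ne_zero.2 hirr.ne_zero
        simp [this, hg2]
      · intro i hi
        have : n - i ≠ 0 := by have := Finset.mem_range.1 hi; omega
        simp [hh2, this]
    · have hroot : f.eval (g.coeff 2 / h.coeff 2) ≠ 0 := by
        intro h0
        have : f.natDegree = 1 :=
          natDegree_eq_of_degree_eq_some (degree_eq_one_of_irreducible_of_root hirr h0)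
        omega
      have hsum : ∑ i ∈ Finset.range (n + 1), f.coeff i * g.coeff 2 ^ i * h.coeff 2 ^ (n - i) =
          h.coeff 2 ^ n * f.eval (g.coeff 2 / h.coeff 2) := by
        rw [eval_eq_sum_range, hf, Finset.mul_sum]
        refine Finset.sum_congr rfl fun i hi ↦ ?_
        have hin : i ≤ n := Nat.lt_succ_iff.1 (Finset.mem_range.1 hi)
        have hpow : h.coeff 2 ^ n = h.coeff 2 ^ (n - i) * h.coeff 2 ^ i := by
          rw [← pow_add, Nat.sub_add_cancel hin]
        rw [hpow, div_pow]
        field_simp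
      rw [hsum]
      exact mul_ne_zero (pow_ne_zero _ hh2) hroot

theorem aeval_eq_of_natDegree_le_two {A : Type*} [CommRing A] [Algebra F A] {g : F[X]}
    (hg : g.natDegree ≤ 2) (x : A) :
    aeval x g = algebraMap F A (g.coeff 2) * x ^ 2 + algebraMap F A (g.coeff 1) * x +
      algebraMap F A (g.coeff 0) := by
  rw [aeval_eq_sum_range' (Nat.lt_succ_of_le hg)]
  simp only [Finset.sum_range_succ, Finset.sum_range_zero, Algebra.smul_def]
  ring

theorem aeval_ne_zero_of_isCoprime {A : Type*} [CommRing A] [Nontrivial A] [Algebra F A]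
    {g h : F[X]} (hcop : IsCoprime g h) {x : A} (hh : aeval x h = 0) : aeval x g ≠ 0 := by
  intro hg
  obtain ⟨u, v, huv⟩ := hcop
  simpa [hg, hh] using congrArg (aeval x) huv

/-- The resultant of two binary quadratic forms does not vanish if they are coprime. -/
theorem resultant_ne_zero_of_coeff_two_ne_zero {g h : F[X]} (hcop : IsCoprime g h)
    (hg : g.natDegree ≤ 2) (hh : h.natDegree ≤ 2) (hh2 : h.coeff 2 ≠ 0) :
    (g.coeff 2 * h.coeff 0 - g.coeff 0 * h.coeff 2) ^ 2 +
      (g.coeff 1 * h.coeff 2 - g.coeff 2 * h.coeff 1) *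
      (g.coeff 1 * h.coeff 0 - g.coeff 0 * h.coeff 1) ≠ 0 := by
  intro h0
  by_cases hp : g.coeff 1 * h.coeff 2 - g.coeff 2 * h.coeff 1 = 0
  · have hs : g.coeff 2 * h.coeff 0 - g.coeff 0 * h.coeff 2 = 0 := by simpa [hp] using h0
    have heq : C (h.coeff 2) * g = C (g.coeff 2) * h := by
      ext k
      rw [coeff_C_mul, coeff_C_mul]
      match k with
      | 0 => linear_combination -hs
      | 1 => linear_combination hp
      | 2 => ring
      | k + 3 =>
        rw [coeff_eq_zero_of_natDegree_lt (by omega : g.natDegree < k + 3),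
          coeff_eq_zero_of_natDegree_lt (by omega : h.natDegree < k + 3)]
        simp
    have hdvd : h ∣ g := by
      refine ⟨C ((h.coeff 2)⁻¹ * g.coeff 2), ?_⟩
      rw [C_mul, mul_comm h, mul_assoc, ← heq, ← mul_assoc, ← C_mul, inv_mul_cancel₀ hh2]
      simp
    have hu : IsUnit h := hcop.isUnit_of_dvd' hdvd dvd_rfl
    have := natDegree_eq_zero_of_isUnit hu
    have := le_natDegree_of_ne_zero hh2
    omega
  · set p := g.coeff 1 * h.coeff 2 - g.coeff 2 * h.coeff 1 with hpdef
    set s := g.coeff 0 * h.coeff 2 - g.coeff 2 * h.coeff 0 with hsdef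
    have hhx : aeval (-s / p) h = 0 := by
      rw [aeval_eq_of_natDegree_le_two hh]
      simp only [Algebra.algebraMap_self, RingHom.id_apply]
      field_simp
      rw [hpdef, hsdef] at *
      linear_combination h.coeff 2 * h0
    have hgx : aeval (-s / p) g = 0 := by
      have hx : p * (-s / p) + s = 0 := by field_simp; ring
      refine (mul_eq_zero.1 (?_ : h.coeff 2 * aeval (-s / p) g = 0)).resolve_left hh2
      rw [aeval_eq_of_natDegree_le_two hh] at hhx
      rw [aeval_eq_of_natDegree_le_two hg]
      simp only [Algebra.algebraMap_self, RingHom.id_apply] at hhx ⊢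
      linear_combination g.coeff 2 * hhx + hx + (-s / p) * hpdef.symm + hsdef.symm
    exact aeval_ne_zero_of_isCoprime hcop hhx hgx

theorem resultant_ne_zero {g h : F[X]} (hcop : IsCoprime g h)
    (hg : g.natDegree ≤ 2) (hh : h.natDegree ≤ 2) (hgh : g.coeff 2 ≠ 0 ∨ h.coeff 2 ≠ 0) :
    (g.coeff 2 * h.coeff 0 - g.coeff 0 * h.coeff 2) ^ 2 +
      (g.coeff 1 * h.coeff 2 - g.coeff 2 * h.coeff 1) *
      (g.coeff 1 * h.coeff 0 - g.coeff 0 * h.coeff 1) ≠ 0 := by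
  rcases hgh with h2 | h2
  · convert! resultant_ne_zero_of_coeff_two_ne_zero hcop.symm hh hg h2 using 1
    ring
  · exact resultant_ne_zero_of_coeff_two_ne_zero hcop hg hh h2

variable {K : Type*} [Field K] [Algebra F K]

/-- The discriminant of the quadratic polynomial `g - x * h`. -/
noncomputable def pencilDiscrim (g h : F[X]) (x : K) : K :=
  discrim (algebraMap F K (g.coeff 2) - x * algebraMap F K (h.coeff 2))
    (algebraMap F K (g.coeff 1) - x * algebraMap F K (h.coeff 1))
    (algebraMap F K (g.coeff 0) - x * algebraMap F K (h.coeff 0))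

theorem sub_mul_coeff_two_ne_zero {g h : F[X]} (hgh : g.coeff 2 ≠ 0 ∨ h.coeff 2 ≠ 0) {x : K}
    (hx : ∀ a : F, algebraMap F K a ≠ x) :
    algebraMap F K (g.coeff 2) - x * algebraMap F K (h.coeff 2) ≠ 0 := by
  intro h0
  by_cases hh2 : h.coeff 2 = 0
  · have := hgh.resolve_right (not_not.2 hh2)
    simp [hh2, this] at h0
  · refine hx (g.coeff 2 / h.coeff 2) ?_
    have : algebraMap F K (h.coeff 2) ≠ 0 := by simpa using hh2
    rw [map_div₀, div_eq_iff this]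
    linear_combination h0

theorem isSquare_pencilDiscrim_iff {g h : F[X]} (hg : g.natDegree ≤ 2)
    (hh : h.natDegree ≤ 2) (hgh : g.coeff 2 ≠ 0 ∨ h.coeff 2 ≠ 0) (h2 : (2 : K) ≠ 0) {x : K}
    (hx : ∀ a : F, algebraMap F K a ≠ x) :
    IsSquare (pencilDiscrim g h x) ↔ ∃ y : K, aeval y g = x * aeval y h := by
  have : NeZero (2 : K) := ⟨h2⟩
  have hiff (y : K) : aeval y g = x * aeval y h ↔
      (algebraMap F K (g.coeff 2) - x * algebraMap F K (h.coeff 2)) * (y * y) +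
      (algebraMap F K (g.coeff 1) - x * algebraMap F K (h.coeff 1)) * y +
      (algebraMap F K (g.coeff 0) - x * algebraMap F K (h.coeff 0)) = 0 := by
    rw [aeval_eq_of_natDegree_le_two hg, aeval_eq_of_natDegree_le_two hh, ← sub_eq_zero]
    constructor <;> intro H <;> linear_combination H
  simp only [hiff]
  constructor
  · exact exists_quadratic_eq_zero (sub_mul_coeff_two_ne_zero hgh hx)
  · rintro ⟨y, hy⟩
    exact ⟨_, (discrim_eq_sq_of_quadratic_eq_zero hy).trans (sq _)⟩

theorem aeval_algebraMap_ne_zero_of_irreducible {f : F[X]} (hirr : Irreducible f)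
    (hdeg : 2 ≤ f.natDegree) {x : K} (hx : aeval x f = 0) (a : F) : algebraMap F K a ≠ x := by
  rintro rfl
  rw [aeval_algebraMap_apply, map_eq_zero, coe_aeval_eq_eval] at hx
  have : f.natDegree = 1 :=
    natDegree_eq_of_degree_eq_some (degree_eq_one_of_irreducible_of_root hirr hx)
  omega

open IntermediateField in
theorem natDegree_minpoly_of_quadratic [FiniteDimensional F K] {g h : F[X]} {x : K}
    (hx : F⟮x⟯ = ⊤) {L : Type*} [Field L] [Algebra F L] [Algebra K L] [IsScalarTower F K L]
    (hL : Module.finrank K L = 2) {y : L} (hcop : IsCoprime g h)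
    (hxy : aeval y g = algebraMap K L x * aeval y h) (hy : ∀ z : K, algebraMap K L z ≠ y) :
    (minpoly F y).natDegree = 2 * Module.finrank F K := by
  have : FiniteDimensional K L := Module.finite_of_finrank_eq_succ hL
  have : FiniteDimensional F L := Module.Finite.trans K L
  have hh : aeval y h ≠ 0 := fun h0 ↦
    aeval_ne_zero_of_isCoprime hcop h0 (by rw [hxy, h0, mul_zero])
  have hmem : algebraMap K L x ∈ F⟮y⟯ := by
    rw [← (div_eq_iff hh).2 hxy]
    have hmem' (p : F[X]) : aeval y p ∈ F⟮y⟯ :=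
      algebra_adjoin_le_adjoin F {y} (aeval_mem_adjoin_singleton F y)
    exact div_mem (hmem' g) (hmem' h)
  have hle : (IsScalarTower.toAlgHom F K L).fieldRange ≤ F⟮y⟯ := by
    rw [AlgHom.fieldRange_eq_map, ← hx, adjoin_map, adjoin_le_iff]
    simpa using hmem
  have hrange : Module.finrank F (IsScalarTower.toAlgHom F K L).fieldRange =
      Module.finrank F K :=
    (AlgEquiv.ofInjectiveField (IsScalarTower.toAlgHom F K L)).toLinearEquiv.finrank_eq.symm
  have hFL : Module.finrank F L = Module.finrank F K * 2 := by
    rw [← hL, Module.finrank_mul_finrank]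
  rw [← adjoin.finrank (.of_finite F y)]
  obtain ⟨a, ha⟩ := finrank_dvd_of_le_right hle
  obtain ⟨b, hb⟩ : Module.finrank F F⟮y⟯ ∣ Module.finrank F L :=
    ⟨_, (Module.finrank_mul_finrank F F⟮y⟯ L).symm⟩
  rw [hrange] at ha
  rw [hFL, ha, mul_assoc] at hb
  have hab : a ∣ 2 := ⟨b, Nat.eq_of_mul_eq_mul_left Module.finrank_pos hb⟩
  rcases (Nat.dvd_prime Nat.prime_two).1 hab with rfl | rfl
  · have heq := eq_of_le_of_finrank_eq hle (by rw [hrange, ha, mul_one])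
    have hy' : y ∈ F⟮y⟯ := mem_adjoin_simple_self F y
    rw [← heq] at hy'
    obtain ⟨z, hz⟩ := hy'
    exact (hy z hz).elim
  · rw [ha, mul_comm]

open IntermediateField in
/-- A version of Capelli's lemma for quadratic transformations. -/
theorem irreducible_quadTransform_iff [FiniteDimensional F K] {n : ℕ} {g h f : F[X]}
    (hK : Module.finrank F K = n) (hn : 2 ≤ n) (hcop : IsCoprime g h) (hg : g.natDegree ≤ 2)
    (hh : h.natDegree ≤ 2) (hgh : g.coeff 2 ≠ 0 ∨ h.coeff 2 ≠ 0) (h2 : (2 : K) ≠ 0)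
    (hf : f.natDegree = n) (hirr : Irreducible f) {x : K} (hx : aeval x f = 0) :
    Irreducible (quadTransform n g h f) ↔ ¬IsSquare (pencilDiscrim g h x) := by
  have hxF := aeval_algebraMap_ne_zero_of_irreducible hirr (hf ▸ hn) hx
  rw [isSquare_pencilDiscrim_iff hg hh hgh h2 hxF]
  have hdeg := natDegree_quadTransform hg hh hgh hf hirr hn
  constructor
  · rintro hP ⟨y, hy⟩
    have h0 : aeval y (quadTransform n g h f) = 0 := by
      rw [aeval_quadTransform hf hy, hx, mul_zero]
    have hmin := minpoly.eq_of_irreducible hP h0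
    have hlc : (quadTransform n g h f).leadingCoeff⁻¹ ≠ 0 := by
      simpa using hP.ne_zero
    have hle := minpoly.natDegree_le (A := F) y
    rw [← hmin, natDegree_mul_C hlc, hdeg, hK] at hle
    omega
  · intro hno
    let Q : K[X] := g.map (algebraMap F K) - C x * h.map (algebraMap F K)
    have hQdeg : Q.natDegree = 2 := by
      refine natDegree_eq_of_le_of_coeff_ne_zero ?_ ?_
      · refine (natDegree_sub_le _ _).trans (max_le (natDegree_map_le.trans hg) ?_)
        exact (natDegree_C_mul_le _ _).trans (natDegree_map_le.trans hh)
      · simpa [Q] using sub_mul_coeff_two_ne_zero hgh hxF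
    have hQ (y : K) : ¬Q.IsRoot y := by
      intro hy
      refine hno ⟨y, ?_⟩
      simpa [Q, sub_eq_zero, eval_map_algebraMap] using hy
    have hQirr : Irreducible Q :=
      irreducible_of_degree_le_three_of_not_isRoot (by simp [hQdeg]) hQ
    have : Fact (Irreducible Q) := ⟨hQirr⟩
    have hL : Module.finrank K (AdjoinRoot Q) = 2 := by
      rw [(AdjoinRoot.powerBasis hQirr.ne_zero).finrank, AdjoinRoot.powerBasis_dim, hQdeg]
    have hQ0 : aeval (AdjoinRoot.root Q) Q = 0 := by
      rw [AdjoinRoot.aeval_eq, AdjoinRoot.mk_self]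
    have hxy : aeval (AdjoinRoot.root Q) g =
        algebraMap K (AdjoinRoot Q) x * aeval (AdjoinRoot.root Q) h := by
      simpa only [Q, map_sub, map_mul, aeval_C, aeval_map_algebraMap, sub_eq_zero] using hQ0
    have hy (z : K) : algebraMap K (AdjoinRoot Q) z ≠ AdjoinRoot.root Q := by
      intro hz
      rw [← hz, aeval_algebraMap_apply, map_eq_zero, coe_aeval_eq_eval] at hQ0
      exact hQ z hQ0
    have htop : F⟮x⟯ = ⊤ := by
      rw [Field.primitive_element_iff_minpoly_natDegree_eq, ← minpoly.eq_of_irreducible hirr hx,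
        natDegree_mul_C (by simpa using hirr.ne_zero), hf, hK]
    have hmin := natDegree_minpoly_of_quadratic htop hL hcop hxy hy
    have hx' : aeval (algebraMap K (AdjoinRoot Q) x) f = 0 := by
      rw [aeval_algebraMap_apply, hx, map_zero]
    have hdvd : minpoly F (AdjoinRoot.root Q) ∣ quadTransform n g h f := by
      refine minpoly.dvd _ _ ?_
      rw [aeval_quadTransform hf hxy, hx', mul_zero]
    have : FiniteDimensional K (AdjoinRoot Q) := Module.finite_of_finrank_eq_succ hL
    have : FiniteDimensional F (AdjoinRoot Q) := Module.Finite.trans K _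
    have hP0 : quadTransform n g h f ≠ 0 := by
      intro h0
      rw [h0, natDegree_zero] at hdeg
      omega
    exact (associated_of_dvd_of_natDegree_le hdvd hP0 (by rw [hmin, hdeg, hK])).irreducible
      (minpoly.irreducible (.of_finite F _))

open IntermediateField in
/-- In an extension of degree `2 ^ m`, an element of a proper subfield has square discriminant. -/
theorem adjoin_eq_top_of_not_isSquare_pencilDiscrim [Finite K] {m : ℕ}
    (hK : Module.finrank F K = 2 ^ m) (hchar : ringChar K ≠ 2) {g h : F[X]} {x : K}
    (hx : ¬IsSquare (pencilDiscrim g h x)) : F⟮x⟯ = ⊤ := by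
  have : FiniteDimensional F K := Module.finite_of_finrank_pos (by rw [hK]; positivity)
  have hdvd : Module.finrank F⟮x⟯ K ∣ 2 ^ m :=
    ⟨_, by rw [← hK, mul_comm, Module.finrank_mul_finrank F F⟮x⟯ K]⟩
  obtain ⟨k, -, hk⟩ := (Nat.dvd_prime_pow Nat.prime_two).1 hdvd
  rcases Nat.eq_zero_or_pos k with rfl | hk0
  · exact finrank_eq_one_iff_eq_top.1 (by simpa using hk)
  · refine (hx ?_).elim
    have hmap : algebraMap F⟮x⟯ K (pencilDiscrim g h (AdjoinSimple.gen F x)) =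
        pencilDiscrim g h x := by
      simp only [pencilDiscrim, discrim, map_sub, map_mul, map_pow, map_ofNat,
        ← IsScalarTower.algebraMap_apply, AdjoinSimple.algebraMap_gen]
    rw [← hmap]
    exact isSquare_algebraMap_of_even_finrank hchar
      (by rw [hk]; exact even_two.pow_of_ne_zero hk0.ne') _

theorem ncard_not_isSquare_pencilDiscrim [Finite F] [Finite K] (hchar : ringChar K ≠ 2)
    (heven : Even (Module.finrank F K)) {g h : F[X]} (hcop : IsCoprime g h)
    (hg : g.natDegree ≤ 2) (hh : h.natDegree ≤ 2) (hgh : g.coeff 2 ≠ 0 ∨ h.coeff 2 ≠ 0) :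
    2 * {x : K | ¬IsSquare (pencilDiscrim g h x)}.ncard = Nat.card K - 1 := by
  have h2 : (2 : K) ≠ 0 := Ring.two_ne_zero hchar
  let a : F := h.coeff 1 ^ 2 - 4 * h.coeff 2 * h.coeff 0
  let b : F := 4 * (g.coeff 2 * h.coeff 0 + g.coeff 0 * h.coeff 2) - 2 * g.coeff 1 * h.coeff 1
  let c : F := g.coeff 1 ^ 2 - 4 * g.coeff 2 * g.coeff 0
  have hquad (x : K) : pencilDiscrim g h x =
      algebraMap F K a * x ^ 2 + algebraMap F K b * x + algebraMap F K c := by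
    simp only [pencilDiscrim, discrim, a, b, c, map_add, map_sub, map_mul, map_pow, map_ofNat]
    ring
  have hdisc : discrim (algebraMap F K a) (algebraMap F K b) (algebraMap F K c) =
      algebraMap F K (discrim a b c) := by
    simp only [discrim, map_sub, map_mul, map_pow, map_ofNat]
  have hdisc0 : algebraMap F K (discrim a b c) ≠ 0 := by
    have : discrim a b c = 2 ^ 4 * ((g.coeff 2 * h.coeff 0 - g.coeff 0 * h.coeff 2) ^ 2 +
      (g.coeff 1 * h.coeff 2 - g.coeff 2 * h.coeff 1) *
      (g.coeff 1 * h.coeff 0 - g.coeff 0 * h.coeff 1)) := by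
      simp only [discrim, a, b, c]
      ring
    rw [this, map_mul, map_pow, map_ofNat]
    exact mul_ne_zero (pow_ne_zero _ h2) 
      ((_root_.map_ne_zero _).2 (resultant_ne_zero hcop hg hh hgh))
  simp only [hquad]
  rw [ncard_not_isSquare_quadratic h2 (isSquare_algebraMap_of_even_finrank hchar heven a)
    (hdisc ▸ isSquare_algebraMap_of_even_finrank hchar heven _) (hdisc ▸ hdisc0),
    two_mul_ncard_not_isSquare hchar]

/-- Grouping the elements of a Galois extension by their minimal polynomials. -/
theorem ncard_eq_mul_ncard_image_minpoly [Finite K] [IsGalois F K] {n : ℕ} (S : Set K)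
    (hdeg : ∀ x ∈ S, (minpoly F x).natDegree = n)
    (hS : ∀ x ∈ S, ∀ y, minpoly F y = minpoly F x → y ∈ S) :
    S.ncard = n * (minpoly F '' S).ncard := by
  classical
  have := Fintype.ofFinite K
  have hSf : S = (S.toFinset : Set K) := by simp
  rw [hSf, ← Finset.coe_image, Set.ncard_coe_finset, Set.ncard_coe_finset,
    Finset.card_eq_sum_card_image (minpoly F), Finset.sum_const_nat (m := n), mul_comm]
  intro p hp
  obtain ⟨x, hx, rfl⟩ := Finset.mem_image.1 hp
  rw [Set.mem_toFinset] at hx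
  have hint : IsIntegral F x := IsGalois.integral F x
  have hroots : Fintype.card ((minpoly F x).rootSet K) = n := by
    rw [card_rootSet_eq_natDegree (IsGalois.separable F x) (IsGalois.splits F x), hdeg x hx]
  rw [← hroots, ← Set.toFinset_card]
  congr 1
  ext y
  simp only [Finset.mem_filter, Set.mem_toFinset, mem_rootSet, ne_eq, minpoly.ne_zero hint,
    not_false_eq_true, true_and]
  constructor
  · rintro ⟨-, hy⟩
    rw [← hy, minpoly.aeval]
  · intro hy
    have hxy := (minpoly.eq_of_irreducible_of_monic (minpoly.irreducible hint) hy
      (minpoly.monic hint)).symm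
    exact ⟨hS x hx y hxy, hxy⟩

end QuadraticTransform

/-- For an odd prime power `q`, `n = 2^m` with `m ≥ 1`, and a quadratic transformation
given by coprime `g, h` with `max(deg g, deg h) = 2`, the number of monic irreducible
polynomials `f` of degree `n` over `F_q` with `h^n f(g/h)` irreducible is
`(q^n - 1)/(2n)`. -/
theorem count_transform_pow_two (F : Type*) [Field F] [Fintype F] (q n m : ℕ)
    (hF : Fintype.card F = q) (hq : Odd q) (hm : 1 ≤ m) (hn : n = 2 ^ m)
    (g h : Polynomial F) (hcop : IsCoprime g h) (hdeg : max g.natDegree h.natDegree = 2) :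
    2 * n * ({f : Polynomial F | f.Monic ∧ Irreducible f ∧ f.natDegree = n ∧
        Irreducible (∑ i ∈ Finset.range (n + 1), C (f.coeff i) * g ^ i * h ^ (n - i))}.ncard)
      = q ^ n - 1 := by
  have hg : g.natDegree ≤ 2 := hdeg ▸ le_max_left _ _
  have hh : h.natDegree ≤ 2 := hdeg ▸ le_max_right _ _
  have hgh : g.coeff 2 ≠ 0 ∨ h.coeff 2 ≠ 0 := by
    have hne {p : F[X]} (hp : p.natDegree = 2) : p.coeff 2 ≠ 0 := by
      rw [← hp]
      exact leadingCoeff_ne_zero.2 (by rintro rfl; simp at hp)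
    rcases max_choice g.natDegree h.natDegree with hmax | hmax
    · exact .inl (hne (hmax ▸ hdeg))
    · exact .inr (hne (hmax ▸ hdeg))
  have hneven : Even n := hn ▸ even_two.pow_of_ne_zero (by omega)
  have hn2 : 2 ≤ n := hn ▸ Nat.le_self_pow (by omega) 2
  obtain ⟨p, hp⟩ := CharP.exists F
  have : Fact p.Prime := ⟨CharP.char_is_prime F p⟩
  have : NeZero n := ⟨by omega⟩
  let K := FiniteField.Extension F p n
  have hK : Module.finrank F K = n := FiniteField.finrank_extension F p n
  have hcardK : Nat.card K = q ^ n := by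
    rw [FiniteField.natCard_extension, Nat.card_eq_fintype_card, hF]
  have := Fintype.ofFinite K
  have hchar : ringChar K ≠ 2 := by
    rw [Ne, FiniteField.even_card_iff_char_two, ← Nat.card_eq_fintype_card, hcardK,
      ← Nat.even_iff, Nat.not_even_iff_odd]
    exact hq.pow
  have h2 : (2 : K) ≠ 0 := Ring.two_ne_zero hchar
  let S : Set K := {x | ¬IsSquare (pencilDiscrim g h x)}
  have hSdeg (x : K) (hx : x ∈ S) : (minpoly F x).natDegree = n :=
    ((Field.primitive_element_iff_minpoly_natDegree_eq F x).1
      (adjoin_eq_top_of_not_isSquare_pencilDiscrim (hK.trans hn) hchar hx)).trans hK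
  have hiff {f : F[X]} (hf : f.natDegree = n) (hirr : Irreducible f) {x : K}
      (hx : aeval x f = 0) : Irreducible (quadTransform n g h f) ↔ x ∈ S :=
    irreducible_quadTransform_iff hK hn2 hcop hg hh hgh h2 hf hirr hx
  have himage : {f : F[X] | f.Monic ∧ Irreducible f ∧ f.natDegree = n ∧
      Irreducible (∑ i ∈ Finset.range (n + 1), C (f.coeff i) * g ^ i * h ^ (n - i))} =
      minpoly F '' S := by
    ext f
    constructor
    · rintro ⟨hmonic, hirr, hf, hP⟩
      have : Fact (Irreducible f) := ⟨hirr⟩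
      have hfin : Module.finrank F (AdjoinRoot f) = n := by
        rw [(AdjoinRoot.powerBasis hirr.ne_zero).finrank, AdjoinRoot.powerBasis_dim, hf]
      let e := FiniteField.algEquivExtension F p n (AdjoinRoot f) hfin
      have hroot : aeval (e (AdjoinRoot.root f)) f = 0 := by
        rw [aeval_algHom_apply, AdjoinRoot.aeval_eq, AdjoinRoot.mk_self, map_zero]
      exact ⟨_, (hiff hf hirr hroot).1 hP,
        (minpoly.eq_of_irreducible_of_monic hirr hroot hmonic).symm⟩
    · rintro ⟨x, hx, rfl⟩
      have hint : IsIntegral F x := .of_finite F x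
      have hirr := minpoly.irreducible hint
      exact ⟨minpoly.monic hint, hirr, hSdeg x hx,
        (hiff (hSdeg x hx) hirr (minpoly.aeval F x)).2 hx⟩
  have hSclosed (x : K) (hx : x ∈ S) (y : K) (hy : minpoly F y = minpoly F x) : y ∈ S := by
    have hirr := minpoly.irreducible (IsIntegral.of_finite F x)
    rw [← hiff (hSdeg x hx) hirr (hy ▸ minpoly.aeval F y),
      hiff (hSdeg x hx) hirr (minpoly.aeval F x)]
    exact hx
  rw [himage, mul_assoc, ← ncard_eq_mul_ncard_image_minpoly S hSdeg hSclosed, ← hcardK]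
  exact ncard_not_isSquare_pencilDiscrim hchar (hK.symm.subst hneven) hcop hg hh hgh
end

section
/- Let q be a prime power, n > 1, and let g(x) = a₁x² + b₁x + c₁ and h(x) = a₂x² + b₂x + c₂ be coprime polynomials over F_q with max(deg g, deg h) = 2, and assume that if q is even then not both b₁ = 0 and b₂ = 0, and if q is odd assume n is not a power of 2. Then the number of monic irreducible polynomials f of degree n over F_q such that h(x)^n · f(g(x)/h(x)) is irreducible over F_q equals (1/(2n)) · ∑_{d | n, d odd} μ(d) · q^{n/d}. -/
open Polynomial ArithmeticFunction

/-- The polynomial `P X ^ (N + 1) + Q (X ^ N + X) + S`, whose roots are the points `x` such that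
`(x, x ^ N)` lies on the symmetric correspondence `P x y + Q (x + y) + S = 0`. -/
noncomputable def symPoly {K : Type*} [Field K] (P Q S : K) (N : ℕ) : K[X] :=
  C P * X ^ (N + 1) + C Q * (X ^ N + X) + C S

theorem eval_symPoly {K : Type*} [Field K] (P Q S : K) (N : ℕ) (x : K) :
    (symPoly P Q S N).eval x = P * x * x ^ N + Q * (x + x ^ N) + S := by
  simp [symPoly]
  ring

theorem natDegree_symPoly {K : Type*} [Field K] [DecidableEq K] {P Q S : K} {N : ℕ}
    (hN : 1 < N) (hd : P * S - Q ^ 2 ≠ 0) :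
    (symPoly P Q S N).natDegree = N + if P = 0 then 0 else 1 := by
  rw [symPoly]
  split_ifs with hP
  · have hQ : Q ≠ 0 := by rintro rfl; simp [hP] at hd
    subst hP
    have h1 : (C Q * (X ^ N + X) + C S : K[X]).natDegree ≤ N := by
      compute_degree
      omega
    refine le_antisymm (by simpa using h1) (le_natDegree_of_ne_zero ?_)
    have h0 : N ≠ 0 := by omega
    have h2 : 1 ≠ N := by omega
    simp [coeff_X, coeff_C, h0, h2, hQ]
  · refine le_antisymm ?_ (le_natDegree_of_ne_zero ?_)
    · compute_degree
    · have h0 : N ≠ 0 := by omega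
      simp [coeff_X, coeff_X_pow, h0, hP]

theorem separable_symPoly {K : Type*} [Field K] {P Q S : K} {N : ℕ}
    (hN : (N : K) = 0) (hd : P * S - Q ^ 2 ≠ 0) : (symPoly P Q S N).Separable := by
  have hder : derivative (symPoly P Q S N) = C P * X ^ N + C Q := by
    simp [symPoly, derivative_X_pow, hN]
  rw [Separable, hder]
  refine ⟨C (P / (P * S - Q ^ 2)), -C (P / (P * S - Q ^ 2)) * X - C (Q / (P * S - Q ^ 2)), ?_⟩
  have h1 : (1 : K[X]) = C (P / (P * S - Q ^ 2)) * C S - C (Q / (P * S - Q ^ 2)) * C Q := by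
    rw [← C_mul, ← C_mul, ← C_sub, ← C_1]
    congr 1
    field_simp
  have h2 : C (P / (P * S - Q ^ 2)) * C Q = C (Q / (P * S - Q ^ 2)) * C P := by
    rw [← C_mul, ← C_mul]
    congr 1
    field_simp
  rw [h1, symPoly]
  linear_combination (X ^ N) * h2

theorem card_roots_symPoly {K : Type*} [Field K] [IsAlgClosed K] [DecidableEq K] {P Q S : K} {N : ℕ}
    (hN : (N : K) = 0) (hN1 : 1 < N) (hd : P * S - Q ^ 2 ≠ 0) :
    (symPoly P Q S N).roots.toFinset.card = N + if P = 0 then 0 else 1 := by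
  rw [Multiset.toFinset_card_of_nodup (nodup_roots (separable_symPoly hN hd)),
    ← (IsAlgClosed.splits _).natDegree_eq_card_roots, natDegree_symPoly hN1 hd]

/-- The correspondence `P x y + Q (x + y) + S = 0` is the graph of an involution. -/
theorem eq_of_symm_form {K : Type*} [Field K] {P Q S x y z : K} (hd : P * S - Q ^ 2 ≠ 0)
    (hxy : P * x * y + Q * (x + y) + S = 0) (hyz : P * y * z + Q * (y + z) + S = 0) : z = x := by
  by_contra hne
  have h1 : P * y + Q = 0 := by
    have : (z - x) * (P * y + Q) = 0 := by linear_combination hyz - hxy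
    exact (mul_eq_zero.1 this).resolve_left (sub_ne_zero.2 hne)
  apply hd
  linear_combination P * hxy - (P * x + Q) * h1

section Frobenius

variable {F K : Type*} [Field F] [Fintype F] [Field K] [Algebra F K]

theorem pow_card_pow_eq_self_iff [Algebra.IsAlgebraic F K] (m : ℕ) (x : K) :
    x ^ Fintype.card F ^ m = x ↔ (minpoly F x).natDegree ∣ m := by
  rw [(minpoly.irreducible (Algebra.IsIntegral.isIntegral x)).natDegree_dvd_iff_dvd_X_pow_card_pow_sub_X,
    minpoly.dvd_iff, Nat.card_eq_fintype_card]
  simp [sub_eq_zero]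

theorem pow_card_pow_eq_pow_of_dvd_sub [Algebra.IsAlgebraic F K] {m d k : ℕ} (x : K) (h : m = d + k)
    (hk : (minpoly F x).natDegree ∣ k) :
    x ^ Fintype.card F ^ m = x ^ Fintype.card F ^ d := by
  rw [h, add_comm, pow_add, pow_mul, (pow_card_pow_eq_self_iff k x).2 hk]

theorem aeval_pow_card_pow (m : ℕ) (f : F[X]) (x : K) :
    aeval (x ^ Fintype.card F ^ m) f = aeval x f ^ Fintype.card F ^ m := by
  have := aeval_algHom_apply (FiniteField.frobeniusAlgHom F K ^ m) x f
  simpa [AlgHom.coe_pow, FiniteField.coe_frobeniusAlgHom, pow_iterate] using this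

theorem algebraMap_pow_card_pow (m : ℕ) (c : F) :
    algebraMap F K c ^ Fintype.card F ^ m = algebraMap F K c := by
  rw [← map_pow, FiniteField.pow_card_pow]

theorem cast_card_pow_eq_zero {m : ℕ} (hm : m ≠ 0) : ((Fintype.card F ^ m : ℕ) : K) = 0 := by
  have : ((Fintype.card F : ℕ) : K) = 0 := by
    rw [← map_natCast (algebraMap F K), FiniteField.cast_card_eq_zero, _root_.map_zero]
  simp [this, hm]

theorem symm_form_pow_card_pow (m : ℕ) (P Q S : F) (x y : K)
    (h : algebraMap F K P * x * y + algebraMap F K Q * (x + y) + algebraMap F K S = 0) :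
    algebraMap F K P * x ^ Fintype.card F ^ m * y ^ Fintype.card F ^ m +
      algebraMap F K Q * (x ^ Fintype.card F ^ m + y ^ Fintype.card F ^ m) +
      algebraMap F K S = 0 := by
  have hφ : ∀ z : K, (FiniteField.frobeniusAlgHom F K ^ m) z = z ^ Fintype.card F ^ m := fun z => by
    simp [AlgHom.coe_pow, FiniteField.coe_frobeniusAlgHom, pow_iterate]
  have := congrArg (FiniteField.frobeniusAlgHom F K ^ m) h
  rwa [map_add, map_add, map_mul, map_mul, map_mul, map_add, AlgHom.commutes, AlgHom.commutes,
    AlgHom.commutes, _root_.map_zero, hφ, hφ] at this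

end Frobenius

section Counting

variable {F K : Type*} [Field F] [Fintype F] [Field K] [Algebra F K]

open Classical in
/-- The points `x` with `x ^ (q ^ m) ≠ x` such that `(x, x ^ (q ^ m))` lies on the symmetric
correspondence `P x y + Q (x + y) + S = 0`. -/
noncomputable def symSet (K : Type*) [Field K] [Algebra F K] (P Q S : F) (m : ℕ) : Finset K :=
  (symPoly (algebraMap F K P) (algebraMap F K Q) (algebraMap F K S)
    (Fintype.card F ^ m)).roots.toFinset.filter fun x => x ^ Fintype.card F ^ m ≠ x

open Classical in
/-- The points `x` with `x ^ (q ^ m) = x` such that `(x, x)` lies on the symmetric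
correspondence `P x y + Q (x + y) + S = 0`. -/
noncomputable def symFixed (K : Type*) [Field K] [Algebra F K] (P Q S : F) (m : ℕ) : Finset K :=
  (symPoly (algebraMap F K P) (algebraMap F K Q) (algebraMap F K S)
    (Fintype.card F ^ m)).roots.toFinset.filter fun x => x ^ Fintype.card F ^ m = x

open Classical in
/-- The points `x` of degree `2 m` such that `(x, x ^ (q ^ m))` lies on the symmetric
correspondence `P x y + Q (x + y) + S = 0`. -/
noncomputable def symExact (K : Type*) [Field K] [Algebra F K] (P Q S : F) (m : ℕ) : Finset K :=
  (symPoly (algebraMap F K P) (algebraMap F K Q) (algebraMap F K S)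
    (Fintype.card F ^ m)).roots.toFinset.filter fun x => (minpoly F x).natDegree = 2 * m

variable {P Q S : F}

theorem one_lt_card_pow {m : ℕ} (hm : m ≠ 0) : 1 < Fintype.card F ^ m :=
  Nat.one_lt_pow hm Fintype.one_lt_card

omit [Fintype F] in
theorem map_disc_ne_zero (hd : P * S - Q ^ 2 ≠ 0) :
    algebraMap F K P * algebraMap F K S - algebraMap F K Q ^ 2 ≠ 0 := by
  rw [← map_mul, ← map_pow, ← map_sub]
  exact (_root_.map_ne_zero _).2 hd

theorem mem_roots_symPoly {m : ℕ} (hm : m ≠ 0) (hd : P * S - Q ^ 2 ≠ 0) (x : K) :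
    x ∈ (symPoly (algebraMap F K P) (algebraMap F K Q) (algebraMap F K S)
      (Fintype.card F ^ m)).roots ↔
    algebraMap F K P * x * x ^ Fintype.card F ^ m +
      algebraMap F K Q * (x + x ^ Fintype.card F ^ m) + algebraMap F K S = 0 := by
  rw [mem_roots (separable_symPoly (cast_card_pow_eq_zero hm) (map_disc_ne_zero hd)).ne_zero,
    IsRoot.def, eval_symPoly]

theorem mem_symSet {m : ℕ} (hm : m ≠ 0) (hd : P * S - Q ^ 2 ≠ 0) (x : K) :
    x ∈ symSet K P Q S m ↔ algebraMap F K P * x * x ^ Fintype.card F ^ m +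
      algebraMap F K Q * (x + x ^ Fintype.card F ^ m) + algebraMap F K S = 0 ∧
      x ^ Fintype.card F ^ m ≠ x := by
  classical
  rw [symSet, Finset.mem_filter, Multiset.mem_toFinset, mem_roots_symPoly hm hd]

theorem mem_symFixed {m : ℕ} (hm : m ≠ 0) (hd : P * S - Q ^ 2 ≠ 0) (x : K) :
    x ∈ symFixed K P Q S m ↔
      algebraMap F K P * x ^ 2 + algebraMap F K (2 * Q) * x + algebraMap F K S = 0 ∧
      x ^ Fintype.card F ^ m = x := by
  classical
  rw [symFixed, Finset.mem_filter, Multiset.mem_toFinset, mem_roots_symPoly hm hd]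
  refine and_congr_left fun h => ?_
  rw [h, map_mul, map_ofNat]
  ring_nf

theorem mem_symExact {m : ℕ} (hm : m ≠ 0) (hd : P * S - Q ^ 2 ≠ 0) (x : K) :
    x ∈ symExact K P Q S m ↔ algebraMap F K P * x * x ^ Fintype.card F ^ m +
      algebraMap F K Q * (x + x ^ Fintype.card F ^ m) + algebraMap F K S = 0 ∧
      (minpoly F x).natDegree = 2 * m := by
  classical
  rw [symExact, Finset.mem_filter, Multiset.mem_toFinset, mem_roots_symPoly hm hd]

open Classical in
theorem card_symSet_add_card_symFixed [IsAlgClosed K] {m : ℕ} (hm : m ≠ 0)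
    (hd : P * S - Q ^ 2 ≠ 0) :
    (symSet K P Q S m).card + (symFixed K P Q S m).card =
      Fintype.card F ^ m + if P = 0 then 0 else 1 := by
  have := card_roots_symPoly (cast_card_pow_eq_zero (F := F) (K := K) hm) (one_lt_card_pow hm)
    (map_disc_ne_zero hd)
  rw [_root_.map_eq_zero] at this
  rw [← this, symSet, symFixed, add_comm]
  exact Finset.card_filter_add_card_filter_not _

theorem card_symSet_eq_sum [Algebra.IsAlgebraic F K] (hd : P * S - Q ^ 2 ≠ 0) (k : ℕ) {t : ℕ}
    (ht : Odd t) :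
    (symSet K P Q S (2 ^ k * t)).card = ∑ i ∈ t.divisors, (symExact K P Q S (2 ^ k * i)).card := by
  classical
  have ht0 : t ≠ 0 := ht.pos.ne'
  have hn0 : 2 ^ k * t ≠ 0 := by positivity
  rw [← Finset.card_biUnion]
  · congr 1
    ext x
    rw [mem_symSet hn0 hd, Finset.mem_biUnion]
    constructor
    · rintro ⟨h1, h2⟩
      have h3 : (x ^ Fintype.card F ^ (2 ^ k * t)) ^ Fintype.card F ^ (2 ^ k * t) = x :=
        eq_of_symm_form (map_disc_ne_zero hd) h1 (symm_form_pow_card_pow _ P Q S _ _ h1)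
      rw [← pow_mul, ← pow_add, pow_card_pow_eq_self_iff,
        show 2 ^ k * t + 2 ^ k * t = 2 ^ (k + 1) * t by ring, Nat.dvd_mul] at h3
      obtain ⟨a, i, ha, hi, hai⟩ := h3
      rw [Ne, pow_card_pow_eq_self_iff] at h2
      obtain ⟨j, hj, rfl⟩ := (Nat.dvd_prime_pow Nat.prime_two).1 ha
      have hjk : j = k + 1 := by
        by_contra hne
        exact h2 (hai ▸ mul_dvd_mul (pow_dvd_pow 2 (by omega)) hi)
      subst hjk
      have hi0 : 2 ^ k * i ≠ 0 := mul_ne_zero (by positivity) (Nat.pos_of_dvd_of_pos hi ht.pos).ne'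
      refine ⟨i, Nat.mem_divisors.2 ⟨hi, ht0⟩, (mem_symExact hi0 hd x).2 ⟨?_, ?_⟩⟩
      · obtain ⟨c, rfl⟩ := hi
        obtain ⟨e, rfl⟩ := (Nat.odd_mul.1 ht).2
        rwa [pow_card_pow_eq_pow_of_dvd_sub (d := 2 ^ k * i) (k := 2 ^ (k + 1) * i * e) x
          (by ring) (hai ▸ dvd_mul_right _ _)] at h1
      · rw [← hai]
        ring
    · rintro ⟨i, hi, hx⟩
      have hit := (Nat.mem_divisors.1 hi).1
      have hi0 : 2 ^ k * i ≠ 0 := mul_ne_zero (by positivity) (Nat.pos_of_mem_divisors hi).ne'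
      obtain ⟨h1, h2⟩ := (mem_symExact hi0 hd x).1 hx
      obtain ⟨c, rfl⟩ := hit
      obtain ⟨e, rfl⟩ := (Nat.odd_mul.1 ht).2
      have h4 := pow_card_pow_eq_pow_of_dvd_sub (F := F) (m := 2 ^ k * (i * (2 * e + 1)))
        (d := 2 ^ k * i) (k := 2 * (2 ^ k * i) * e) x (by ring) (h2 ▸ dvd_mul_right _ _)
      rw [h4]
      refine ⟨h1, ?_⟩
      rw [Ne, pow_card_pow_eq_self_iff, h2]
      intro h
      have := Nat.le_of_dvd (Nat.pos_of_ne_zero hi0) h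
      omega
  · intro i hi j hj hij
    refine Finset.disjoint_left.2 fun x hx hx' => hij ?_
    have hx := (Finset.mem_filter.1 hx).2
    have hx' := (Finset.mem_filter.1 hx').2
    have : 2 * (2 ^ k * i) = 2 * (2 ^ k * j) := hx.symm.trans hx'
    simpa using this

omit [Fintype F] in
theorem natDegree_minpoly_le_of_aeval_eq_zero {x : K} {p : F[X]} (hp : p ≠ 0)
    (h : aeval x p = 0) : (minpoly F x).natDegree ≤ p.natDegree :=
  natDegree_le_of_dvd (minpoly.dvd F x h) hp

theorem symFixed_eq [Algebra.IsAlgebraic F K] (hd : P * S - Q ^ 2 ≠ 0)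
    (h2 : P = 0 → S = 0 → (2 : F) ≠ 0) {m n : ℕ} (hm : m ≠ 0) (hn : n ≠ 0)
    (hmn : 2 ∣ m ↔ 2 ∣ n) : symFixed K P Q S m = symFixed K P Q S n := by
  ext x
  rw [mem_symFixed hm hd, mem_symFixed hn hd]
  refine and_congr_right fun hx => ?_
  rw [pow_card_pow_eq_self_iff, pow_card_pow_eq_self_iff]
  have hp : C P * X ^ 2 + C (2 * Q) * X + C S ≠ 0 := by
    intro h
    have hP : P = 0 := by simpa [coeff_X, coeff_C] using congrArg (coeff · 2) h
    have hS : S = 0 := by simpa [coeff_X, coeff_C] using congrArg (coeff · 0) h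
    have hQ : 2 * Q = 0 := by simpa [coeff_X, coeff_C, -mul_eq_zero] using congrArg (coeff · 1) h
    have hQ' : Q = 0 := (mul_eq_zero.1 hQ).resolve_left (h2 hP hS)
    simp [hP, hQ'] at hd
  have hle := (natDegree_minpoly_le_of_aeval_eq_zero (x := x) hp (by simpa using hx)).trans
    natDegree_quadratic_le
  have hpos := minpoly.natDegree_pos (Algebra.IsIntegral.isIntegral (R := F) x)
  obtain h | h : (minpoly F x).natDegree = 1 ∨ (minpoly F x).natDegree = 2 := by omega
  · simp [h]
  · rwa [h]

open Classical in
theorem card_symFixed_of_two_eq_zero (hd : P * S - Q ^ 2 ≠ 0)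
    (h2 : (2 : F) = 0) (hPS : P = 0 → S ≠ 0) {m : ℕ} (hm : m ≠ 0) :
    (symFixed K P Q S m).card = if P = 0 then 0 else 1 := by
  have : CharP F 2 := CharTwo.of_one_ne_zero_of_two_eq_zero one_ne_zero h2
  have : CharP K 2 := charP_of_injective_algebraMap (algebraMap F K).injective 2
  split_ifs with hP
  · refine Finset.card_eq_zero.2 (Finset.eq_empty_of_forall_notMem fun x hx => hPS hP ?_)
    simpa [hP, h2] using ((mem_symFixed hm hd x).1 hx).1
  · obtain ⟨s, hs⟩ := FiniteField.isSquare_of_char_two (ringChar.eq F 2) (S / P)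
    rw [Finset.card_eq_one]
    refine ⟨algebraMap F K s, ?_⟩
    have hS : S = P * s ^ 2 := by
      field_simp at hs
      rw [hs]
    ext x
    rw [mem_symFixed hm hd, Finset.mem_singleton]
    have hP' : algebraMap F K P ≠ 0 := (_root_.map_ne_zero _).2 hP
    constructor
    · rintro ⟨h, -⟩
      rw [h2, zero_mul, _root_.map_zero, zero_mul, add_zero, hS, map_mul, map_pow, ← mul_add,
        ← CharTwo.add_sq, mul_eq_zero, or_iff_right hP', sq_eq_zero_iff,
        CharTwo.add_eq_zero] at h
      exact h
    · rintro rfl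
      refine ⟨?_, algebraMap_pow_card_pow m s⟩
      rw [h2, zero_mul, _root_.map_zero, zero_mul, add_zero, hS, map_mul, map_pow,
        CharTwo.add_self_eq_zero]

end Counting

theorem sum_odd_divisors_two_pow_mul {R : Type*} [AddCommMonoid R] (k : ℕ) {t : ℕ}
    (ht : Odd t) (f : ℕ → R) :
    ∑ d ∈ (2 ^ k * t).divisors.filter Odd, f d = ∑ d ∈ t.divisors, f d := by
  congr 1
  ext d
  have ht0 : t ≠ 0 := ht.pos.ne'
  simp only [Finset.mem_filter, Nat.mem_divisors]
  constructor
  · rintro ⟨⟨h1, -⟩, h2⟩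
    exact ⟨Nat.Coprime.dvd_of_dvd_mul_left (h2.coprime_two_right.pow_right k) h1, ht0⟩
  · rintro ⟨h1, -⟩
    exact ⟨⟨h1.mul_left _, by positivity⟩, Odd.of_dvd_nat ht h1⟩

theorem card_symExact {F K : Type*} [Field F] [Fintype F] [Field K] [Algebra F K]
    [IsAlgClosed K] [Algebra.IsAlgebraic F K] {P Q S : F} (hd : P * S - Q ^ 2 ≠ 0)
    (heven : (2 : F) = 0 → P = 0 → S ≠ 0) {n : ℕ} (hn : n ≠ 0)
    (hodd : (2 : F) ≠ 0 → ¬ ∃ m, n = 2 ^ m) :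
    ((symExact K P Q S n).card : ℤ) =
      ∑ d ∈ n.divisors.filter (fun d => Odd d),
        (moebius d : ℤ) * (Fintype.card F : ℤ) ^ (n / d) := by
  classical
  obtain ⟨k, t, ht, rfl⟩ := Nat.exists_eq_two_pow_mul_odd hn
  have ht0 : t ≠ 0 := ht.pos.ne'
  set E : ℤ := (if P = 0 then 0 else 1) - ((symFixed K P Q S (2 ^ k * t)).card : ℤ) with hE
  have hV : ∀ i ∈ t.divisors, ((symSet K P Q S (2 ^ k * i)).card : ℤ) =
      (Fintype.card F : ℤ) ^ (2 ^ k * i) + E := by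
    intro i hi
    have hit := (Nat.mem_divisors.1 hi).1
    have hi0 : i ≠ 0 := (Nat.pos_of_mem_divisors hi).ne'
    have hi1 : Odd i := Odd.of_dvd_nat ht hit
    have h := card_symSet_add_card_symFixed (K := K) (m := 2 ^ k * i) (by positivity) hd
    rw [symFixed_eq hd (fun hP hS h2 => heven h2 hP hS) (by positivity) hn (by
      rw [Nat.prime_two.dvd_mul, Nat.prime_two.dvd_mul, or_iff_left hi1.not_two_dvd_nat,
        or_iff_left ht.not_two_dvd_nat])] at h
    zify at h
    rw [hE]
    linarith
  have hE0 : (∑ d ∈ t.divisors, (moebius d : ℤ)) * E = 0 := by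
    by_cases h2 : (2 : F) = 0
    · rw [hE, card_symFixed_of_two_eq_zero hd h2 (heven h2) hn]
      simp
    · have ht1 : t ≠ 1 := fun h => hodd h2 ⟨k, by rw [h, mul_one]⟩
      rw [← coe_mul_zeta_apply, moebius_mul_coe_zeta, one_apply_ne ht1, zero_mul]
  have hinv := (sum_eq_iff_sum_mul_moebius_eq_on (R := ℤ)
    (f := fun i => ((symExact K P Q S (2 ^ k * i)).card : ℤ))
    (g := fun i => ((symSet K P Q S (2 ^ k * i)).card : ℤ)) {i | Odd i}
    (fun a b hab hb => Odd.of_dvd_nat hb hab)).1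
    (fun i _ hi => by rw [card_symSet_eq_sum hd k hi]; push_cast; rfl) t ht.pos ht
  simp only [Int.cast_id] at hinv
  rw [← hinv, Nat.sum_divisorsAntidiagonal
    (fun a b => moebius a * ((symSet K P Q S (2 ^ k * b)).card : ℤ)),
    sum_odd_divisors_two_pow_mul k ht]
  trans ∑ d ∈ t.divisors, ((moebius d : ℤ) * (Fintype.card F : ℤ) ^ (2 ^ k * t / d) +
    (moebius d : ℤ) * E)
  · refine Finset.sum_congr rfl fun d hd => ?_
    have hdt := (Nat.mem_divisors.1 hd).1
    rw [hV _ (Nat.mem_divisors.2 ⟨Nat.div_dvd_of_dvd hdt, ht0⟩), Nat.mul_div_assoc _ hdt]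
    simp [mul_add]
  · rw [Finset.sum_add_distrib, ← Finset.sum_mul, hE0, add_zero]

section QuadraticTransform

variable {F : Type*} [Field F]

/-- The transform `h ^ n * f (g / h)`. -/
noncomputable def fracTransform (g h f : F[X]) (n : ℕ) : F[X] :=
  ∑ i ∈ Finset.range (n + 1), C (f.coeff i) * g ^ i * h ^ (n - i)

theorem aeval_fracTransform {K : Type*} [Field K] [Algebra F K] {g h f : F[X]} {n : ℕ}
    (hf : f.natDegree = n) {x : K} (hx : aeval x h ≠ 0) :
    aeval x (fracTransform g h f n) = aeval x h ^ n * aeval (aeval x g / aeval x h) f := by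
  rw [fracTransform, map_sum, aeval_eq_sum_range (p := f), hf, Finset.mul_sum]
  refine Finset.sum_congr rfl fun i hi => ?_
  have hi : i ≤ n := by simpa [Nat.lt_succ_iff] using hi
  rw [map_mul, map_mul, map_pow, map_pow, aeval_C, Algebra.smul_def, div_pow,
    ← Nat.sub_add_cancel hi, pow_add, Nat.add_sub_cancel]
  field_simp

theorem aeval_fracTransform_of_aeval_eq_zero {K : Type*} [Field K] [Algebra F K] {g h f : F[X]}
    {n : ℕ} {x : K} (hx : aeval x h = 0) :
    aeval x (fracTransform g h f n) = algebraMap F K (f.coeff n) * aeval x g ^ n := by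
  rw [fracTransform, map_sum, Finset.sum_range_succ, Finset.sum_eq_zero fun i hi => ?_]
  · simp
  · have : n - i ≠ 0 := by have := Finset.mem_range.1 hi; omega
    simp [hx, this]

theorem natDegree_fracTransform {g h f : F[X]} (hdeg : max g.natDegree h.natDegree = 2) {n : ℕ}
    (hn : 1 < n) (hf : Irreducible f) (hfn : f.natDegree = n) :
    (fracTransform g h f n).natDegree = n * 2 := by
  have hg : g.natDegree ≤ 2 := hdeg ▸ le_max_left _ _
  have hh : h.natDegree ≤ 2 := hdeg ▸ le_max_right _ _
  refine le_antisymm (natDegree_sum_le_of_forall_le _ _ fun i hi => ?_)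
    (le_natDegree_of_ne_zero ?_)
  · have hi : i ≤ n := by simpa [Nat.lt_succ_iff] using hi
    calc _ ≤ 0 + i * 2 + (n - i) * 2 := natDegree_mul_le_of_le (natDegree_mul_le_of_le
            (natDegree_C _).le (natDegree_pow_le_of_le i hg)) (natDegree_pow_le_of_le _ hh)
      _ = n * 2 := by omega
  · have hcoeff : (fracTransform g h f n).coeff (n * 2) =
        ∑ i ∈ Finset.range (n + 1), f.coeff i * g.coeff 2 ^ i * h.coeff 2 ^ (n - i) := by
      rw [fracTransform, finsetSum_coeff]
      refine Finset.sum_congr rfl fun i hi => ?_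
      have hi : i ≤ n := by simpa [Nat.lt_succ_iff] using hi
      rw [show n * 2 = i * 2 + (n - i) * 2 by omega, mul_assoc, mul_assoc, coeff_C_mul,
        coeff_mul_add_eq_of_natDegree_le (natDegree_pow_le_of_le i hg)
          (natDegree_pow_le_of_le _ hh), coeff_pow_of_natDegree_le hg,
        coeff_pow_of_natDegree_le hh]
    rw [hcoeff]
    by_cases h0 : h.coeff 2 = 0
    · rw [Finset.sum_range_succ, Finset.sum_eq_zero fun i hi => ?_]
      · have hg0 : g.coeff 2 ≠ 0 := by
          intro hg0
          have key : ∀ p : F[X], p.coeff 2 = 0 → p.natDegree ≠ 2 := by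
            intro p hp hp2
            rw [← hp2, coeff_natDegree, leadingCoeff_eq_zero] at hp
            simp [hp] at hp2
          rcases max_choice g.natDegree h.natDegree with hmax | hmax
          · exact key g hg0 (hmax ▸ hdeg)
          · exact key h h0 (hmax ▸ hdeg)
        have : f.coeff n ≠ 0 := by
          rw [← hfn]
          exact leadingCoeff_ne_zero.2 hf.ne_zero
        simp [this, hg0]
      · have : n - i ≠ 0 := by have := Finset.mem_range.1 hi; omega
        simp [h0, this]
    · intro hsum
      have hroot : f.IsRoot (g.coeff 2 / h.coeff 2) := by
        rw [IsRoot.def, eval_eq_sum_range, hfn]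
        have : h.coeff 2 ^ n * ∑ i ∈ Finset.range (n + 1),
            f.coeff i * (g.coeff 2 / h.coeff 2) ^ i = 0 := by
          rw [← hsum, Finset.mul_sum]
          refine Finset.sum_congr rfl fun i hi => ?_
          have hi : i ≤ n := by simpa [Nat.lt_succ_iff] using hi
          rw [div_pow, ← Nat.sub_add_cancel hi, pow_add, Nat.add_sub_cancel]
          field_simp
        exact (mul_eq_zero.1 this).resolve_left (pow_ne_zero _ h0)
      have : f.natDegree = 1 :=
        natDegree_eq_of_degree_eq_some (degree_eq_one_of_irreducible_of_root hf hroot)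
      omega

theorem eq_zero_of_proportional {g h : F[X]} (hcop : IsCoprime g h)
    (hdeg : max g.natDegree h.natDegree = 2) {u v : F} (huv : C v * g = C u * h) :
    u = 0 ∧ v = 0 := by
  have key : ∀ {g h : F[X]} {u v : F}, IsCoprime g h → max g.natDegree h.natDegree = 2 →
      C v * g = C u * h → v = 0 := by
    intro g h u v hcop hdeg huv
    by_contra hv
    have hg : g = C (u / v) * h := by
      have : C v * (g - C (u / v) * h) = 0 := by
        rw [mul_sub, huv, ← mul_assoc, ← C_mul, mul_div_cancel₀ _ hv, sub_self]
      exact sub_eq_zero.1 ((mul_eq_zero.1 this).resolve_left (C_ne_zero.2 hv))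
    have hu : IsUnit h := hcop.isUnit_of_dvd' (hg ▸ dvd_mul_left _ _) dvd_rfl
    have hh : h.natDegree = 0 := natDegree_eq_zero_of_isUnit hu
    have hg' : g.natDegree ≤ h.natDegree := hg ▸ natDegree_C_mul_le _ _
    omega
  exact ⟨key hcop.symm (max_comm g.natDegree _ ▸ hdeg) huv.symm, key hcop hdeg huv⟩

theorem disc_ne_zero {a₁ b₁ c₁ a₂ b₂ c₂ : F} {g h : F[X]}
    (hg : g = C a₁ * X ^ 2 + C b₁ * X + C c₁) (hh : h = C a₂ * X ^ 2 + C b₂ * X + C c₂)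
    (hcop : IsCoprime g h) (hdeg : max g.natDegree h.natDegree = 2) :
    (a₁ * b₂ - a₂ * b₁) * (b₁ * c₂ - b₂ * c₁) - (a₁ * c₂ - a₂ * c₁) ^ 2 ≠ 0 := by
  intro hd
  have key : ∀ u v : F, v * a₁ = u * a₂ → v * b₁ = u * b₂ → v * c₁ = u * c₂ → u = 0 ∧ v = 0 := by
    intro u v h1 h2 h3
    refine eq_zero_of_proportional hcop hdeg ?_
    simp only [hg, hh, mul_add, ← mul_assoc, ← C_mul, h1, h2, h3]
  by_cases hP : a₁ * b₂ - a₂ * b₁ = 0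
  · have hQ : a₁ * c₂ - a₂ * c₁ = 0 := by simpa [hP] using hd
    obtain ⟨rfl, rfl⟩ := key a₁ a₂ (mul_comm _ _) (by linear_combination -hP)
      (by linear_combination -hQ)
    have h1 : g.natDegree ≤ 1 := by
      rw [hg, C_0, zero_mul, zero_add]
      exact natDegree_linear_le
    have h2 : h.natDegree ≤ 1 := by
      rw [hh, C_0, zero_mul, zero_add]
      exact natDegree_linear_le
    omega
  · obtain ⟨x, hx⟩ : ∃ x, (a₁ * b₂ - a₂ * b₁) * x + (a₁ * c₂ - a₂ * c₁) = 0 :=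
      ⟨-(a₁ * c₂ - a₂ * c₁) / (a₁ * b₂ - a₂ * b₁), by field_simp; ring⟩
    have hx' : (a₁ * c₂ - a₂ * c₁) * x + (b₁ * c₂ - b₂ * c₁) = 0 := by
      have : (a₁ * b₂ - a₂ * b₁) * ((a₁ * c₂ - a₂ * c₁) * x + (b₁ * c₂ - b₂ * c₁)) = 0 := by
        linear_combination hd + (a₁ * c₂ - a₂ * c₁) * hx
      exact (mul_eq_zero.1 this).resolve_left hP
    obtain ⟨hu, hv⟩ := key (a₁ * x ^ 2 + b₁ * x + c₁) (a₂ * x ^ 2 + b₂ * x + c₂)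
      (by linear_combination hx) (by linear_combination hx' - x * hx)
      (by linear_combination (-x) * hx')
    obtain ⟨r, s, hrs⟩ := hcop
    have := congrArg (eval x) hrs
    simp [hg, hh, hu, hv] at this

theorem cross_sub_cross_eq {K : Type*} [Field K] [Algebra F K] {a₁ b₁ c₁ a₂ b₂ c₂ : F}
    {g h : F[X]}
    (hg : g = C a₁ * X ^ 2 + C b₁ * X + C c₁) (hh : h = C a₂ * X ^ 2 + C b₂ * X + C c₂) (x y : K) :
    aeval x g * aeval y h - aeval y g * aeval x h =
      (x - y) * (algebraMap F K (a₁ * b₂ - a₂ * b₁) * x * y +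
        algebraMap F K (a₁ * c₂ - a₂ * c₁) * (x + y) + algebraMap F K (b₁ * c₂ - b₂ * c₁)) := by
  simp [hg, hh]
  ring

variable {K : Type*} [Field K] [Algebra F K] [Algebra.IsAlgebraic F K] [Fintype F]
  {a₁ b₁ c₁ a₂ b₂ c₂ : F} {g h f : F[X]} {n : ℕ}

theorem symm_form_of_root (hg : g = C a₁ * X ^ 2 + C b₁ * X + C c₁)
    (hh : h = C a₂ * X ^ 2 + C b₂ * X + C c₂) {x : K} {m : ℕ} (hhx : aeval x h ≠ 0)
    (hx : ¬ (minpoly F x).natDegree ∣ m)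
    (hα : (minpoly F (aeval x g / aeval x h)).natDegree ∣ m) :
    algebraMap F K (a₁ * b₂ - a₂ * b₁) * x * x ^ Fintype.card F ^ m +
      algebraMap F K (a₁ * c₂ - a₂ * c₁) * (x + x ^ Fintype.card F ^ m) +
      algebraMap F K (b₁ * c₂ - b₂ * c₁) = 0 := by
  have hcross := cross_sub_cross_eq hg hh x (x ^ Fintype.card F ^ m)
  rw [← pow_card_pow_eq_self_iff] at hx hα
  have h0 : aeval x g * aeval (x ^ Fintype.card F ^ m) h -
      aeval (x ^ Fintype.card F ^ m) g * aeval x h = 0 := by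
    rw [aeval_pow_card_pow, aeval_pow_card_pow]
    rw [div_pow, div_eq_div_iff (pow_ne_zero _ hhx) hhx] at hα
    rw [hα, sub_self]
  rw [h0] at hcross
  exact (mul_eq_zero.1 hcross.symm).resolve_left (sub_ne_zero.2 (Ne.symm hx))

theorem fracTransform_minpoly_of_mem_symExact (hg : g = C a₁ * X ^ 2 + C b₁ * X + C c₁)
    (hh : h = C a₂ * X ^ 2 + C b₂ * X + C c₂)
    (hcop : IsCoprime g h) (hdeg : max g.natDegree h.natDegree = 2) (hn : 1 < n) {x : K}
    (hx : x ∈ symExact K (a₁ * b₂ - a₂ * b₁) (a₁ * c₂ - a₂ * c₁) (b₁ * c₂ - b₂ * c₁) n) :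
    (minpoly F (aeval x g / aeval x h)).natDegree = n ∧
      Irreducible (fracTransform g h (minpoly F (aeval x g / aeval x h)) n) ∧
      aeval x (fracTransform g h (minpoly F (aeval x g / aeval x h)) n) = 0 := by
  have hd := disc_ne_zero hg hh hcop hdeg
  obtain ⟨h1, h2⟩ := (mem_symExact (by omega) hd x).1 hx
  have hh0 : h ≠ 0 := by
    rintro rfl
    have := natDegree_eq_zero_of_isUnit (isCoprime_zero_right.1 hcop)
    simp [this] at hdeg
  have hhx : aeval x h ≠ 0 := by
    intro h0
    have := natDegree_minpoly_le_of_aeval_eq_zero hh0 h0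
    omega
  have hcross := cross_sub_cross_eq hg hh x (x ^ Fintype.card F ^ n)
  rw [h1, mul_zero, aeval_pow_card_pow, aeval_pow_card_pow, sub_eq_zero] at hcross
  have hdvd : (minpoly F (aeval x g / aeval x h)).natDegree ∣ n := by
    rw [← pow_card_pow_eq_self_iff, div_pow, div_eq_div_iff (pow_ne_zero _ hhx) hhx, hcross]
  have hint := Algebra.IsIntegral.isIntegral (R := F) (aeval x g / aeval x h)
  have hpos := minpoly.natDegree_pos hint
  have hle := Nat.le_of_dvd (by omega) hdvd
  have hdn : (minpoly F (aeval x g / aeval x h)).natDegree = n := by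
    have h3 := symm_form_of_root (m := (minpoly F (aeval x g / aeval x h)).natDegree) hg hh hhx
      (fun hdvd' => by have := Nat.le_of_dvd hpos hdvd'; omega) dvd_rfl
    have h4 := eq_of_symm_form (map_disc_ne_zero hd) h3 (symm_form_pow_card_pow _ _ _ _ _ _ h3)
    rw [← pow_mul, ← pow_add, pow_card_pow_eq_self_iff] at h4
    have := Nat.le_of_dvd (by omega) h4
    omega
  have hroot : aeval x (fracTransform g h (minpoly F (aeval x g / aeval x h)) n) = 0 := by
    rw [aeval_fracTransform hdn hhx, minpoly.aeval, mul_zero]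
  have hT := natDegree_fracTransform hdeg hn (minpoly.irreducible hint) hdn
  refine ⟨hdn, ?_, hroot⟩
  have hT0 : fracTransform g h (minpoly F (aeval x g / aeval x h)) n ≠ 0 := by
    intro h0
    rw [h0, natDegree_zero] at hT
    omega
  exact (associated_of_dvd_of_natDegree_le (minpoly.dvd F x hroot) hT0 (by omega)).irreducible
    (minpoly.irreducible (Algebra.IsIntegral.isIntegral x))

theorem mem_symExact_of_aeval_fracTransform (hg : g = C a₁ * X ^ 2 + C b₁ * X + C c₁)
    (hh : h = C a₂ * X ^ 2 + C b₂ * X + C c₂)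
    (hcop : IsCoprime g h) (hdeg : max g.natDegree h.natDegree = 2) (hn : 1 < n)
    (hfm : f.Monic) (hf : Irreducible f) (hfn : f.natDegree = n)
    (hT : Irreducible (fracTransform g h f n)) {x : K} (hx : aeval x (fracTransform g h f n) = 0) :
    x ∈ symExact K (a₁ * b₂ - a₂ * b₁) (a₁ * c₂ - a₂ * c₁) (b₁ * c₂ - b₂ * c₁) n ∧
      minpoly F (aeval x g / aeval x h) = f := by
  have hdegx : (minpoly F x).natDegree = 2 * n := by
    rw [← minpoly.eq_of_irreducible hT hx, natDegree_mul_C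
      (inv_ne_zero (leadingCoeff_ne_zero.2 hT.ne_zero)), natDegree_fracTransform hdeg hn hf hfn,
      mul_comm]
  have hhx : aeval x h ≠ 0 := by
    intro h0
    rw [aeval_fracTransform_of_aeval_eq_zero h0, ← hfn, hfm.coeff_natDegree, map_one, one_mul] at hx
    have hgx := pow_eq_zero_iff (by omega) |>.1 hx
    obtain ⟨r, s, hrs⟩ := hcop
    have := congrArg (aeval x) hrs
    simp [hgx, h0] at this
  have hα : minpoly F (aeval x g / aeval x h) = f := by
    refine (minpoly.eq_of_irreducible_of_monic hf ?_ hfm).symm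
    rw [aeval_fracTransform hfn hhx] at hx
    exact (mul_eq_zero.1 hx).resolve_left (pow_ne_zero _ hhx)
  refine ⟨(mem_symExact (by omega) (disc_ne_zero hg hh hcop hdeg) x).2 ⟨?_, hdegx⟩, hα⟩
  refine symm_form_of_root hg hh hhx (fun hdvd => ?_) (by rw [hα, hfn])
  have := Nat.le_of_dvd (by omega) hdvd
  omega

open Classical in
theorem ncard_irreducible_fracTransform [IsAlgClosed K]
    (hg : g = C a₁ * X ^ 2 + C b₁ * X + C c₁) (hh : h = C a₂ * X ^ 2 + C b₂ * X + C c₂)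
    (hcop : IsCoprime g h) (hdeg : max g.natDegree h.natDegree = 2) (hn : 1 < n) :
    2 * n * {f : F[X] | f.Monic ∧ Irreducible f ∧ f.natDegree = n ∧
      Irreducible (fracTransform g h f n)}.ncard =
    (symExact K (a₁ * b₂ - a₂ * b₁) (a₁ * c₂ - a₂ * c₁) (b₁ * c₂ - b₂ * c₁) n).card := by
  set W := symExact K (a₁ * b₂ - a₂ * b₁) (a₁ * c₂ - a₂ * c₁) (b₁ * c₂ - b₂ * c₁) n
  set ψ : K → F[X] := fun x => minpoly F (aeval x g / aeval x h)
  have hset : {f : F[X] | f.Monic ∧ Irreducible f ∧ f.natDegree = n ∧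
      Irreducible (fracTransform g h f n)} = ↑(W.image ψ) := by
    ext f
    rw [Set.mem_ofPred_eq, Finset.mem_coe, Finset.mem_image]
    constructor
    · rintro ⟨hfm, hf, hfn, hT⟩
      obtain ⟨x, hx⟩ := IsAlgClosed.exists_aeval_eq_zero K (fracTransform g h f n) hT.degree_pos.ne'
      exact ⟨x, mem_symExact_of_aeval_fracTransform hg hh hcop hdeg hn hfm hf hfn hT hx⟩
    · rintro ⟨x, hx, rfl⟩
      have hint := Algebra.IsIntegral.isIntegral (R := F) (aeval x g / aeval x h)
      obtain ⟨h1, h2, -⟩ := fracTransform_minpoly_of_mem_symExact hg hh hcop hdeg hn hx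
      exact ⟨minpoly.monic hint, minpoly.irreducible hint, h1, h2⟩
  rw [hset, Set.ncard_coe_finset, Finset.card_eq_sum_card_image ψ W, mul_comm]
  refine (Finset.sum_const_nat fun f hf => ?_).symm
  have hfG : f ∈ (↑(W.image ψ) : Set F[X]) := hf
  rw [← hset] at hfG
  obtain ⟨hfm, hf, hfn, hT⟩ := hfG
  have hroots : (W.filter fun x => ψ x = f) = ((fracTransform g h f n).aroots K).toFinset := by
    ext x
    rw [Finset.mem_filter, Multiset.mem_toFinset, mem_aroots]
    constructor
    · rintro ⟨hx, rfl⟩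
      exact ⟨hT.ne_zero, (fracTransform_minpoly_of_mem_symExact hg hh hcop hdeg hn hx).2.2⟩
    · rintro ⟨-, hx⟩
      exact mem_symExact_of_aeval_fracTransform hg hh hcop hdeg hn hfm hf hfn hT hx
  rw [hroots, Multiset.toFinset_card_of_nodup (nodup_aroots_iff_of_splits hT.ne_zero
    (IsAlgClosed.splits _) |>.2 (PerfectField.separable_of_irreducible hT)),
    ← (IsAlgClosed.splits _).natDegree_eq_card_roots, natDegree_map,
    natDegree_fracTransform hdeg hn hf hfn, mul_comm]

end QuadraticTransform

/-- General count of monic irreducible `f` of degree `n > 1` over `F_q` whose quadratic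
transform `h^n f(g/h)` is irreducible, for coprime `g = a₁x²+b₁x+c₁`, `h = a₂x²+b₂x+c₂`
with `max(deg g, deg h) = 2`; if `q` is even assume not both `b₁ = b₂ = 0`, and if
`q` is odd assume `n` is not a power of 2.  The count is
`(1/(2n)) ∑_{d ∣ n, d odd} μ(d) q^{n/d}`. -/
theorem count_transform_general (F : Type*) [Field F] [Fintype F] (q n : ℕ)
    (hF : Fintype.card F = q) (hn : 1 < n)
    (a₁ b₁ c₁ a₂ b₂ c₂ : F) (g h : Polynomial F)
    (hg : g = C a₁ * X ^ 2 + C b₁ * X + C c₁) (hh : h = C a₂ * X ^ 2 + C b₂ * X + C c₂)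
    (hcop : IsCoprime g h) (hdeg : max g.natDegree h.natDegree = 2)
    (heven : Even q → ¬ (b₁ = 0 ∧ b₂ = 0))
    (hodd : Odd q → ¬ ∃ m : ℕ, n = 2 ^ m) :
    (2 * n : ℤ) * ({f : Polynomial F | f.Monic ∧ Irreducible f ∧ f.natDegree = n ∧
        Irreducible (∑ i ∈ Finset.range (n + 1),
          C (f.coeff i) * g ^ i * h ^ (n - i))}.ncard : ℤ)
      = ∑ d ∈ n.divisors.filter (fun d => Odd d), (moebius d : ℤ) * (q : ℤ) ^ (n / d) := by
  subst hF
  set P := a₁ * b₂ - a₂ * b₁ with hP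
  set Q := a₁ * c₂ - a₂ * c₁ with hQ
  set S := b₁ * c₂ - b₂ * c₁ with hS
  have hd : P * S - Q ^ 2 ≠ 0 := disc_ne_zero hg hh hcop hdeg
  have hcount := ncard_irreducible_fracTransform (K := AlgebraicClosure F) hg hh hcop hdeg hn
  rw [← card_symExact (K := AlgebraicClosure F) hd ?_ (by omega) ?_, ← hcount]
  · push_cast
    rfl
  · intro h2 hP0 hS0
    have hchar : CharP F 2 := CharTwo.of_one_ne_zero_of_two_eq_zero one_ne_zero h2
    have hq : Even (Fintype.card F) :=
      Nat.even_iff.2 (FiniteField.even_card_iff_char_two.1 (ringChar.eq F 2))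
    refine heven hq ?_
    have hQ0 : Q ≠ 0 := by
      intro h
      simp [h, hP0] at hd
    have h₁ : b₁ * Q = 0 := by linear_combination a₁ * hS0 + c₁ * hP0
    have h₂ : b₂ * Q = 0 := by linear_combination a₂ * hS0 + c₂ * hP0
    exact ⟨(mul_eq_zero.1 h₁).resolve_right hQ0, (mul_eq_zero.1 h₂).resolve_right hQ0⟩
  · intro h2
    refine hodd (Nat.odd_iff.2 (FiniteField.odd_card_of_char_ne_two fun hc => h2 ?_))
    have : CharP F 2 := ringChar.of_eq hc
    exact CharTwo.two_eq_zero
end
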